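/- arXiv:1309.5379 — 3 statements merged into one kernel-verified Lean document; each statement's English description precedes it below -/
import Mathlib

section
/- Assume a non-hamiltonian 1-tough graph G on n ≥ 3 vertices with σ₃(G) ≥ n, a longest cycle C with a vertex u off C and v on C with v⁺, v⁻ ∈ N(u), and B = N(u) ∪ N(v) dividing C into intervals. If all intervals on C are pairwise inner-disconnected (no edge of G joins an inner vertex of one interval to an inner vertex of another), then at least two intervals have length greater than 3. -/
open scoped Classical

namespace Paper

noncomputable section

variable {V : Type*}

/-- degree as cardinality of neighbor set -/
def deg (G : SimpleGraph V) (x : V) : ℕ := (G.neighborSet x).ncard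

/-- G is 1-tough -/
def OneTough (G : SimpleGraph V) : Prop :=
  ∀ S : Set V, S.Nonempty → Nat.card ((G.induce Sᶜ).ConnectedComponent) ≤ S.ncard

def IsIndepTriple (G : SimpleGraph V) (s : Finset V) : Prop :=
  s.card = 3 ∧ ∀ x ∈ s, ∀ y ∈ s, x ≠ y → ¬ G.Adj x y

def sigma3 [Fintype V] (G : SimpleGraph V) : ℕ :=
  if ∃ s : Finset V, IsIndepTriple G s then
    sInf {k | ∃ s : Finset V, IsIndepTriple G s ∧ ∑ x ∈ s, deg G x = k}
  else 3 * (Fintype.card V - 1)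

def NC2 [Fintype V] (G : SimpleGraph V) : ℕ :=
  if G = ⊤ then Fintype.card V - 1
  else sInf {k | ∃ x y : V, G.dist x y = 2 ∧ (G.neighborSet x ∪ G.neighborSet y).ncard = k}

def circumference (G : SimpleGraph V) : ℕ :=
  sSup {k | ∃ (a : V) (w : G.Walk a a), w.IsCycle ∧ w.length = k}

def IsLongestCycle (G : SimpleGraph V) {a : V} (c : G.Walk a a) : Prop :=
  c.IsCycle ∧ ∀ (b : V) (w : G.Walk b b), w.IsCycle → w.length ≤ c.length

/-- successor of a vertex along the oriented cycle `c` (identity off the cycle) -/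
def cSucc [DecidableEq V] {G : SimpleGraph V} {a : V} (c : G.Walk a a) (x : V) : V :=
  if h : x ∈ c.support.tail then c.support.tail.next x h else x

/-- predecessor of a vertex along the oriented cycle `c` (identity off the cycle) -/
def cPred [DecidableEq V] {G : SimpleGraph V} {a : V} (c : G.Walk a a) (x : V) : V :=
  if h : x ∈ c.support.tail then c.support.tail.prev x h else x

/-- vertices strictly between `x` and `y` going forward along `c` -/
def arc [DecidableEq V] {G : SimpleGraph V} {a : V} (c : G.Walk a a) (x y : V) : Set V :=
  {z | ∃ i k : ℕ, 0 < i ∧ i < k ∧ k < c.length ∧ (cSucc c)^[k] x = y ∧ z = (cSucc c)^[i] x}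

/-- length of the interval of the cycle `c` starting at `b` determined by `B` -/
def intervalLen [DecidableEq V] {G : SimpleGraph V} {a : V} (c : G.Walk a a)
    (B : Set V) (b : V) : ℕ :=
  sInf {k | 0 < k ∧ (cSucc c)^[k] b ∈ B}

/-- inner vertices of the interval of the cycle `c` starting at `b` determined by `B` -/
def innerVerts [DecidableEq V] {G : SimpleGraph V} {a : V} (c : G.Walk a a)
    (B : Set V) (b : V) : Set V :=
  {x | ∃ i, 0 < i ∧ i < intervalLen c B b ∧ x = (cSucc c)^[i] b}

/-- the union of the neighborhoods of the vertices in `S` -/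
def nbhdSet (G : SimpleGraph V) (S : Set V) : Set V := {z | ∃ y ∈ S, G.Adj y z}

/-- a set of vertices is independent -/
def IsIndepSet (G : SimpleGraph V) (S : Set V) : Prop :=
  ∀ x ∈ S, ∀ y ∈ S, ¬ G.Adj x y

open SimpleGraph

/-- `G` has a path from `a` to `b` whose vertex set is `S`, of size `n`. -/
def PathOn (G : SimpleGraph V) (S : Set V) (n : ℕ) (a b : V) : Prop :=
  ∃ w : G.Walk a b, w.IsPath ∧ w.length + 1 = n ∧ ∀ x, x ∈ w.support ↔ x ∈ S

namespace PathOn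

variable {G : SimpleGraph V} {S T : Set V} {n k : ℕ} {a b x y : V}

lemma single (G : SimpleGraph V) (a : V) : PathOn G {a} 1 a a :=
  ⟨.nil, by simp, by simp, by simp⟩

lemma symm (h : PathOn G S n a b) : PathOn G S n b a := by
  obtain ⟨w, hw, hl, hs⟩ := h
  exact ⟨w.reverse, hw.reverse, by simpa using hl, by simpa using hs⟩

lemma join (h : PathOn G S n a b) (hbx : G.Adj b x) (h' : PathOn G T k x y)
    (hd : ∀ z ∈ S, z ∉ T) : PathOn G (S ∪ T) (n + k) a y := by
  obtain ⟨w, hw, hl, hs⟩ := h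
  obtain ⟨w', hw', hl', hs'⟩ := h'
  have hsupp : (w.append (.cons hbx w')).support = w.support ++ w'.support := by
    simp [Walk.support_append]
  refine ⟨w.append (.cons hbx w'), ?_, ?_, ?_⟩
  · rw [Walk.isPath_def, hsupp, List.nodup_append]
    refine ⟨hw.support_nodup, hw'.support_nodup, ?_⟩
    rintro p hp q hq rfl
    exact hd p ((hs p).1 hp) ((hs' p).1 hq)
  · simp only [Walk.length_append, Walk.length_cons]
    omega
  · intro z
    rw [hsupp]
    simp [hs, hs']

lemma exists_isCycle (h : PathOn G S n a b) (hba : G.Adj b a) (hn : 3 ≤ n) :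
    ∃ w : G.Walk b b, w.IsCycle ∧ w.length = n := by
  obtain ⟨w, hw, hl, -⟩ := h
  refine ⟨.cons hba w, ?_, by simpa using hl⟩
  rw [Walk.isCycle_iff_isPath_tail_and_le_length]
  exact ⟨by simpa using hw, by simp only [Walk.length_cons]; omega⟩

lemma exists_of_reachable_induce (s : Set V) (a b : s) (h : (G.induce s).Reachable a b) :
    ∃ (U : Set V) (n : ℕ), PathOn G U n a b ∧ (a ≠ b → 2 ≤ n) ∧ 1 ≤ n ∧
      ∀ x ∈ U, ∃ hx : x ∈ s, (G.induce s).Reachable ⟨x, hx⟩ b := by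
  classical
  obtain ⟨w, hw⟩ := h.exists_isPath
  let f : G.induce s →g G := (Embedding.induce s).toHom
  refine ⟨{x | x ∈ (w.map f).support}, w.length + 1, ⟨w.map f, ?_,
    congrArg (· + 1) (Walk.length_map f w), fun x => Iff.rfl⟩, ?_, by omega, ?_⟩
  · exact hw.map (f := f) (Embedding.induce (G := G) s).injective
  · intro hab
    have : w.length ≠ 0 := fun h0 => hab (Walk.eq_of_length_eq_zero h0)
    omega
  · intro x hx
    simp only [Walk.support_map, List.mem_map, Set.mem_ofPred_eq] at hx
    obtain ⟨y, hy, rfl⟩ := hx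
    exact ⟨y.2, ⟨w.dropUntil y hy⟩⟩

end PathOn

/-- `p 0, …, p (m - 1)` is a path of `G` whose ends are both adjacent to the two further vertices
`u` and `v`, and no cycle of `G` has more than `m + 1` vertices. -/
structure TwinFrame (G : SimpleGraph V) (m : ℕ) (p : ℕ → V) (u v : V) : Prop where
  two_le : 2 ≤ m
  inj : ∀ i < m, ∀ j < m, p i = p j → i = j
  adj : ∀ i, i + 1 < m → G.Adj (p i) (p (i + 1))
  ne : u ≠ v
  ne_u : ∀ i < m, p i ≠ u
  ne_v : ∀ i < m, p i ≠ v
  u_first : G.Adj u (p 0)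
  u_last : G.Adj u (p (m - 1))
  v_first : G.Adj v (p 0)
  v_last : G.Adj v (p (m - 1))
  max : ∀ (S : Set V) (n : ℕ) (a b : V), PathOn G S n a b → G.Adj b a → 3 ≤ n → n ≤ m + 1

namespace TwinFrame

variable {G : SimpleGraph V} {m : ℕ} {p : ℕ → V} {u v : V}

lemma swap (F : TwinFrame G m p u v) : TwinFrame G m p v u :=
  ⟨F.two_le, F.inj, F.adj, F.ne.symm, F.ne_v, F.ne_u, F.v_first, F.v_last, F.u_first, F.u_last,
    F.max⟩

lemma rev (F : TwinFrame G m p u v) : TwinFrame G m (fun i => p (m - 1 - i)) u v where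
  two_le := F.two_le
  inj i hi j hj h := by
    have := F.inj _ (by omega) _ (by omega) h
    omega
  adj i hi := by
    have := F.adj (m - 1 - (i + 1)) (by omega)
    rw [show m - 1 - (i + 1) + 1 = m - 1 - i by omega] at this
    exact this.symm
  ne := F.ne
  ne_u i hi := F.ne_u _ (by omega)
  ne_v i hi := F.ne_v _ (by omega)
  u_first := by simpa using F.u_last
  u_last := by simpa using F.u_first
  v_first := by simpa using F.v_last
  v_last := by simpa using F.v_first
  max := F.max

/-- The vertices `p i, …, p j`. -/
def seg (p : ℕ → V) (i j : ℕ) : Set V := {x | ∃ k, i ≤ k ∧ k ≤ j ∧ p k = x}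

lemma mem_seg {p : ℕ → V} {i j : ℕ} {x : V} : x ∈ seg p i j ↔ ∃ k, i ≤ k ∧ k ≤ j ∧ p k = x := Iff.rfl

lemma pathOn_seg (F : TwinFrame G m p u v) (i j : ℕ) (hij : i ≤ j) (hj : j < m) :
    PathOn G (seg p i j) (j + 1 - i) (p i) (p j) := by
  induction j, hij using Nat.le_induction with
  | base =>
    have : seg p i i = {p i} := by
      ext x
      simp only [seg, Set.mem_ofPred_eq, Set.mem_singleton_iff]
      exact ⟨fun ⟨k, h1, h2, h3⟩ => by rw [← h3, le_antisymm h1 h2],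
        fun h => ⟨i, le_rfl, le_rfl, h.symm⟩⟩
    rw [this, Nat.add_sub_cancel_left]
    exact PathOn.single G _
  | succ j hij ih =>
    have := (ih (by omega)).join (F.adj j hj) (PathOn.single G _) (by
      rintro z ⟨k, -, hk, rfl⟩ h
      have := F.inj _ (by omega) _ hj h
      omega)
    have hS : seg p i (j + 1) = seg p i j ∪ {p (j + 1)} := by
      ext x
      simp only [seg, Set.mem_ofPred_eq, Set.mem_union, Set.mem_singleton_iff]
      constructor
      · rintro ⟨k, h1, h2, rfl⟩
        rcases Nat.lt_or_ge j k with h | h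
        · right; congr 1; omega
        · left; exact ⟨k, h1, h, rfl⟩
      · rintro (⟨k, h1, h2, rfl⟩ | rfl)
        · exact ⟨k, h1, by omega, rfl⟩
        · exact ⟨j + 1, by omega, le_rfl, rfl⟩
    rw [hS, show j + 1 + 1 - i = j + 1 - i + 1 by omega]
    exact this

/-- A set of vertices avoiding the cycle `v, p 0, …, p (m - 1)`. -/
def Off (m : ℕ) (p : ℕ → V) (v : V) (U : Set V) : Prop :=
  v ∉ U ∧ ∀ i < m, p i ∉ U

lemma insert_le (F : TwinFrame G m p u v) {W : Set V} {n : ℕ} {a b : V} (hW : PathOn G W n a b)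
    (hoff : Off m p v W) {i : ℕ} (hi : i + 1 < m) (ha : G.Adj (p i) a) (hb : G.Adj b (p (i + 1))) :
    n = 0 := by
  have h := (((F.pathOn_seg 0 i (by omega) (by omega)).join ha hW ?_).join hb
    (F.pathOn_seg (i + 1) (m - 1) (by omega) (by omega)) ?_).join F.v_last.symm
      (PathOn.single G v) ?_
  · have := F.max _ _ _ _ h F.v_first (by omega)
    omega
  all_goals grind [mem_seg, Off, F.inj, F.ne_u, F.ne_v]

section hanging

variable {U : Set V} {n : ℕ} {h : V}

lemma not_adj_of_hanging (F : TwinFrame G m p u v) (hU : PathOn G U n h u) (hoff : Off m p v U)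
    (hn : 1 ≤ n) : ¬ G.Adj h v := by
  intro hv
  have hm := F.two_le
  have hc := ((F.pathOn_seg 0 (m - 1) (by omega) (by omega)).join F.u_last.symm hU.symm
    ?_).join hv (PathOn.single G v) ?_
  · have := F.max _ _ _ _ hc F.v_first (by omega)
    omega
  all_goals grind [mem_seg, Off, F.inj, F.ne_u, F.ne_v]

lemma gap_le (F : TwinFrame G m p u v) (hU : PathOn G U n h u) (hoff : Off m p v U)
    (hn : 1 ≤ n) {i j : ℕ} (hij : i < j) (hj : j < m) (hi : G.Adj h (p i)) (hv : G.Adj v (p j)) :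
    n + 1 ≤ j - i := by
  have hm := F.two_le
  have hc := (((F.pathOn_seg 0 i (by omega) (by omega)).join hi.symm hU ?_).join F.u_last
    (F.pathOn_seg j (m - 1) (by omega) (by omega)).symm ?_).join hv.symm (PathOn.single G v) ?_
  · have := F.max _ _ _ _ hc F.v_first (by omega)
    omega
  all_goals grind [mem_seg, Off, F.inj, F.ne_u, F.ne_v]

lemma gap_le' (F : TwinFrame G m p u v) (hU : PathOn G U n h u) (hoff : Off m p v U)
    (hn : 1 ≤ n) {i j : ℕ} (hij : j < i) (hj : i < m) (hi : G.Adj h (p i)) (hv : G.Adj v (p j)) :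
    n + 1 ≤ i - j := by
  have hoff' : Off m (fun i => p (m - 1 - i)) v U := ⟨hoff.1, fun i hi => hoff.2 _ (by omega)⟩
  have := F.rev.gap_le hU hoff' hn (i := m - 1 - i) (j := m - 1 - j) (by omega) (by omega)
    (by rwa [show m - 1 - (m - 1 - i) = i by omega])
    (by rwa [show m - 1 - (m - 1 - j) = j by omega])
  omega

lemma hanging_succ_not_adj (F : TwinFrame G m p u v) (hoff : Off m p v {h}) {i j : ℕ} (hij : i < j)
    (hj : j + 1 < m) (hi : G.Adj h (p i)) (hj' : G.Adj h (p j)) :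
    ¬ G.Adj (p (i + 1)) (p (j + 1)) := by
  intro hadj
  have hc := ((((PathOn.single G h).join hj'
    (F.pathOn_seg (i + 1) j (by omega) (by omega)).symm ?_).join hadj
    (F.pathOn_seg (j + 1) (m - 1) (by omega) (by omega)) ?_).join F.v_last.symm
    (PathOn.single G v) ?_).join F.v_first (F.pathOn_seg 0 i (by omega) (by omega)) ?_
  · have := F.max _ _ _ _ hc hi.symm (by omega)
    omega
  all_goals grind [mem_seg, Off, F.inj, F.ne_u, F.ne_v]

lemma hanging_succ_not_adj_before (F : TwinFrame G m p u v) (hU : PathOn G U n h u)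
    (hoff : Off m p v U) (hn : 2 ≤ n) {d s : ℕ} (hs : s + 2 ≤ d) (hd : d + 1 < m)
    (hhd : G.Adj h (p d)) (hvs : G.Adj v (p s)) : ¬ G.Adj (p (d + 1)) (p (s + 2)) := by
  intro hadj
  have hc := ((((hU.symm.join hhd
    (F.pathOn_seg (s + 2) d (by omega) (by omega)).symm ?_).join hadj.symm
    (F.pathOn_seg (d + 1) (m - 1) (by omega) (by omega)) ?_).join F.v_last.symm
    (PathOn.single G v) ?_).join hvs (F.pathOn_seg 0 s (by omega) (by omega)).symm ?_)
  · have := F.max _ _ _ _ hc F.u_first.symm (by omega)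
    omega
  all_goals grind [mem_seg, Off, F.inj, F.ne_u, F.ne_v]

lemma hanging_succ_not_adj_after (F : TwinFrame G m p u v) (hU : PathOn G U n h u)
    (hoff : Off m p v U) (hn : 2 ≤ n) {d s : ℕ} (hs : d < s) (hsm : s + 2 < m)
    (hhd : G.Adj h (p d)) (hvs : G.Adj v (p s)) : ¬ G.Adj (p (d + 1)) (p (s + 2)) := by
  intro hadj
  have hc := ((((hU.symm.join hhd
    (F.pathOn_seg 0 d (by omega) (by omega)).symm ?_).join F.v_first.symm
    (PathOn.single G v) ?_).join hvs
    (F.pathOn_seg (d + 1) s (by omega) (by omega)).symm ?_).join hadj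
    (F.pathOn_seg (s + 2) (m - 1) (by omega) (by omega)) ?_)
  · have := F.max _ _ _ _ hc F.u_last.symm (by omega)
    omega
  all_goals grind [mem_seg, Off, F.inj, F.ne_u, F.ne_v]

lemma hanging_succ_not_adj_first (F : TwinFrame G m p u v) (hU : PathOn G U n h u)
    (hoff : Off m p v U) (hn : 2 ≤ n) {d : ℕ} (hd : d + 1 < m)
    (hhd : G.Adj h (p d)) : ¬ G.Adj (p (d + 1)) (p 0) := by
  intro hadj
  have hc := (hU.symm.join hhd
    (F.pathOn_seg 0 d (by omega) (by omega)).symm ?_).join hadj.symm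
    (F.pathOn_seg (d + 1) (m - 1) (by omega) (by omega)) ?_
  · have := F.max _ _ _ _ hc F.u_last.symm (by omega)
    omega
  all_goals grind [mem_seg, Off, F.inj, F.ne_u, F.ne_v]

lemma hanging_succ_no_common (F : TwinFrame G m p u v) (hU : PathOn G U n h u)
    (hoff : Off m p v U) {r : V} (hr : Off m p v {r}) (hrU : r ∉ U) {d : ℕ} (hd : d + 1 < m)
    (hhd : G.Adj h (p d)) (hvr : G.Adj v r) : ¬ G.Adj (p (d + 1)) r := by
  intro hadj
  have hc := ((((PathOn.single G r).join hadj.symm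
    (F.pathOn_seg (d + 1) (m - 1) (by omega) (by omega)) ?_).join F.u_last.symm
    hU.symm ?_).join hhd (F.pathOn_seg 0 d (by omega) (by omega)).symm ?_).join F.v_first.symm
    (PathOn.single G v) ?_
  · have := F.max _ _ _ _ hc hvr (by omega)
    omega
  all_goals grind [mem_seg, Off, F.inj, F.ne_u, F.ne_v]

lemma hanging_not_adj_first (F : TwinFrame G m p u v) (hU : PathOn G U n h u)
    (hoff : Off m p v U) (hn : 2 ≤ n) : ¬ G.Adj h (p 0) := by
  intro hadj
  have hm := F.two_le
  have hc := hU.symm.join hadj (F.pathOn_seg 0 (m - 1) (by omega) (by omega)) ?_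
  · have := F.max _ _ _ _ hc F.u_last.symm (by omega)
    omega
  all_goals grind [mem_seg, Off, F.inj, F.ne_u, F.ne_v]

lemma hanging_not_adj_last (F : TwinFrame G m p u v) (hU : PathOn G U n h u)
    (hoff : Off m p v U) (hn : 2 ≤ n) : ¬ G.Adj h (p (m - 1)) := by
  simpa using F.rev.hanging_not_adj_first hU ⟨hoff.1, fun i hi => hoff.2 _ (by omega)⟩ hn

end hanging

/-- An attachment of a vertex `w` off the cycle to the successor of a neighbour of `u` is
incompatible with further attachments of `w` right after neighbours of `u` or `v`. -/
lemma not_adj_succ_of_u (F : TwinFrame G m p u v) {w : V} (hw : Off m p v {w}) (hwu : w ≠ u)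
    {i s e : ℕ} (hi : i + 1 < m) (hui : G.Adj u (p i)) (hwi : G.Adj w (p (i + 1)))
    (hs : G.Adj u (p s)) (hsi : s ≠ i) (hse : s < e) (hes : e ≤ s + 2) (hem : e < m)
    (hcross : s < i → e ≤ i) : ¬ G.Adj w (p e) := by
  intro hwe
  rcases Nat.lt_or_ge i s with h | h
  · have hc := (((((PathOn.single G w).join hwi
      (F.pathOn_seg (i + 1) s (by omega) (by omega)) ?_).join hs.symm
      (PathOn.single G u) ?_).join hui
      (F.pathOn_seg 0 i (by omega) (by omega)).symm ?_).join F.v_first.symm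
      (PathOn.single G v) ?_).join F.v_last
      (F.pathOn_seg e (m - 1) (by omega) (by omega)).symm ?_
    · have := F.max _ _ _ _ hc hwe.symm (by omega)
      omega
    all_goals grind [mem_seg, Off, F.inj, F.ne_u, F.ne_v, F.ne]
  · have hc := (((((PathOn.single G w).join hwi
      (F.pathOn_seg (i + 1) (m - 1) (by omega) (by omega)) ?_).join F.v_last.symm
      (PathOn.single G v) ?_).join F.v_first
      (F.pathOn_seg 0 s (by omega) (by omega)) ?_).join hs.symm
      (PathOn.single G u) ?_).join hui
      (F.pathOn_seg e i (by omega) (by omega)).symm ?_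
    · have := F.max _ _ _ _ hc hwe.symm (by omega)
      omega
    all_goals grind [mem_seg, Off, F.inj, F.ne_u, F.ne_v, F.ne]

lemma not_adj_succ_of_v (F : TwinFrame G m p u v) {w : V} (hw : Off m p v {w}) (hwu : w ≠ u)
    {i s e : ℕ} (hi : i + 1 < m) (hui : G.Adj u (p i)) (hwi : G.Adj w (p (i + 1)))
    (hs : G.Adj v (p s)) (hsi : s ≠ i) (hse : s < e) (hes : e ≤ s + 2) (hem : e < m)
    (hcross : s < i → e ≤ i) : ¬ G.Adj w (p e) := by
  intro hwe
  rcases Nat.lt_or_ge i s with h | h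
  · have hc := (((((PathOn.single G w).join hwi
      (F.pathOn_seg (i + 1) s (by omega) (by omega)) ?_).join hs.symm
      (PathOn.single G v) ?_).join F.v_first
      (F.pathOn_seg 0 i (by omega) (by omega)) ?_).join hui.symm
      (PathOn.single G u) ?_).join F.u_last
      (F.pathOn_seg e (m - 1) (by omega) (by omega)).symm ?_
    · have := F.max _ _ _ _ hc hwe.symm (by omega)
      omega
    all_goals grind [mem_seg, Off, F.inj, F.ne_u, F.ne_v, F.ne]
  · have hc := (((((PathOn.single G w).join hwi
      (F.pathOn_seg (i + 1) (m - 1) (by omega) (by omega)) ?_).join F.v_last.symm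
      (PathOn.single G v) ?_).join hs
      (F.pathOn_seg 0 s (by omega) (by omega)).symm ?_).join F.u_first.symm
      (PathOn.single G u) ?_).join hui
      (F.pathOn_seg e i (by omega) (by omega)).symm ?_
    · have := F.max _ _ _ _ hc hwe.symm (by omega)
      omega
    all_goals grind [mem_seg, Off, F.inj, F.ne_u, F.ne_v, F.ne]

lemma not_adj_first_of_u (F : TwinFrame G m p u v) {w : V} (hw : Off m p v {w}) (hwu : w ≠ u)
    {i : ℕ} (hi : i + 1 < m) (hui : G.Adj u (p i)) (hwi : G.Adj w (p (i + 1))) :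
    ¬ G.Adj w (p 0) := by
  intro hw0
  have hc := (((PathOn.single G w).join hw0
    (F.pathOn_seg 0 i (by omega) (by omega)) ?_).join hui.symm
    (PathOn.single G u) ?_).join F.u_last
    (F.pathOn_seg (i + 1) (m - 1) (by omega) (by omega)).symm ?_
  · have := F.max _ _ _ _ hc hwi.symm (by omega)
    omega
  all_goals grind [mem_seg, Off, F.inj, F.ne_u, F.ne_v, F.ne]

lemma u_insert (F : TwinFrame G m p u v) {i : ℕ} (hi : i + 1 < m) (h : G.Adj u (p i)) :
    ¬ G.Adj u (p (i + 1)) := fun h' => by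
  have := F.insert_le (PathOn.single G u)
    ⟨by simpa using F.ne.symm, fun i hi => by simpa using F.ne_u i hi⟩ hi h.symm h'
  omega

section degrees

/-- The indices of the neighbours of `x` among `p 0, …, p (m - 1)`. -/
def idx (G : SimpleGraph V) (m : ℕ) (p : ℕ → V) (x : V) : Finset ℕ :=
  (Finset.range m).filter fun i => G.Adj x (p i)

@[simp]
lemma mem_idx {x : V} {i : ℕ} : i ∈ idx G m p x ↔ i < m ∧ G.Adj x (p i) := by
  simp [idx]

variable [Fintype V]

/-- The vertices off the cycle `v, p 0, …, p (m - 1)`. -/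
def offVerts (m : ℕ) (p : ℕ → V) (v : V) : Finset V :=
  Finset.univ.filter fun r => Off m p v {r}

/-- The neighbours of `x` off the cycle `v, p 0, …, p (m - 1)`. -/
def offNbrs (G : SimpleGraph V) (m : ℕ) (p : ℕ → V) (v x : V) : Finset V :=
  (offVerts m p v).filter fun r => G.Adj x r

@[simp]
lemma mem_offVerts {r : V} : r ∈ offVerts m p v ↔ Off m p v {r} := by
  simp [offVerts]

@[simp]
lemma mem_offNbrs {x r : V} : r ∈ offNbrs G m p v x ↔ Off m p v {r} ∧ G.Adj x r := by
  simp [offNbrs]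

lemma deg_le_card_add_card {x : V} (hx : ¬ G.Adj x v) :
    deg G x ≤ (idx G m p x).card + (offNbrs G m p v x).card := by
  have hsub : G.neighborSet x ⊆ ((idx G m p x).image p ∪ offNbrs G m p v x : Finset V) := by
    intro y hy
    rw [SimpleGraph.mem_neighborSet] at hy
    by_cases h : ∃ i < m, p i = y
    · obtain ⟨i, hi, rfl⟩ := h
      simp only [Finset.coe_union, Set.mem_union, Finset.mem_coe, Finset.mem_image]
      exact Or.inl ⟨i, by simp [hi, hy], rfl⟩
    · push Not at h
      have : v ≠ y := fun e => hx (e ▸ hy)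
      simp only [Finset.coe_union, Set.mem_union, Finset.mem_coe, mem_offNbrs, Off,
        Set.mem_singleton_iff]
      exact Or.inr ⟨⟨this, h⟩, hy⟩
  calc deg G x ≤ ((idx G m p x).image p ∪ offNbrs G m p v x).card := by
        rw [← Set.ncard_coe_finset]
        exact Set.ncard_le_ncard hsub (Finset.finite_toSet _)
    _ ≤ _ := (Finset.card_union_le _ _).trans (Nat.add_le_add_right Finset.card_image_le _)

lemma card_offVerts_le (F : TwinFrame G m p u v) :
    (offVerts m p v).card + m + 1 ≤ Fintype.card V := by
  have hv : v ∉ (Finset.range m).image p := by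
    simp only [Finset.mem_image, Finset.mem_range, not_exists, not_and]
    exact F.ne_v
  have hd : Disjoint (offVerts m p v) (insert v ((Finset.range m).image p)) := by
    rw [Finset.disjoint_left]
    intro r hr h
    rw [mem_offVerts] at hr
    simp only [Finset.mem_insert, Finset.mem_image, Finset.mem_range] at h
    rcases h with rfl | ⟨i, hi, rfl⟩
    · exact hr.1 rfl
    · exact hr.2 i hi rfl
  have hp : ((Finset.range m).image p).card = m := by
    rw [Finset.card_image_of_injOn, Finset.card_range]
    intro i hi j hj h
    exact F.inj i (by simpa using hi) j (by simpa using hj) h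
  have := Finset.card_le_univ (offVerts m p v ∪ insert v ((Finset.range m).image p))
  rw [Finset.card_union_of_disjoint hd, Finset.card_insert_of_notMem hv, hp] at this
  omega

end degrees

end TwinFrame

lemma le_deg_add_deg_add_deg [Fintype V] {G : SimpleGraph V}
    (hsig : Fintype.card V ≤ sigma3 G) {x y z : V} (hxy : x ≠ y) (hxz : x ≠ z) (hyz : y ≠ z)
    (axy : ¬ G.Adj x y) (axz : ¬ G.Adj x z) (ayz : ¬ G.Adj y z) :
    Fintype.card V ≤ deg G x + deg G y + deg G z := by
  have ht : IsIndepTriple G {x, y, z} := by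
    refine ⟨Finset.card_eq_three.2 ⟨x, y, z, hxy, hxz, hyz, rfl⟩, ?_⟩
    simp only [Finset.mem_insert, Finset.mem_singleton]
    rintro a (rfl | rfl | rfl) b (rfl | rfl | rfl) hab h <;>
      first | exact hab rfl | exact axy h | exact axz h | exact ayz h | exact axy h.symm |
        exact axz h.symm | exact ayz h.symm
  refine hsig.trans ?_
  rw [sigma3, if_pos ⟨_, ht⟩]
  refine Nat.sInf_le ⟨_, ht, ?_⟩
  rw [Finset.sum_insert (by simp [hxy, hxz]), Finset.sum_pair hyz, add_assoc]

namespace TwinFrame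

variable {G : SimpleGraph V} {m : ℕ} {p : ℕ → V} {u v : V}

section order

variable {U : Set V} {n : ℕ} {h : V}

lemma v_insert (F : TwinFrame G m p u v) {i : ℕ} (hi : i + 1 < m) (hv : G.Adj v (p i)) :
    ¬ G.Adj v (p (i + 1)) := F.swap.u_insert hi hv

lemma index_bounds_of_hanging (F : TwinFrame G m p u v) (hU : PathOn G U n h u) (hoff : Off m p v U)
    (hn : 2 ≤ n) {d : ℕ} (hd : d < m) (hhd : G.Adj h (p d)) : 3 ≤ d ∧ d + 4 ≤ m := by
  have hm := F.two_le
  have h0 : d ≠ 0 := by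
    rintro rfl
    exact F.hanging_not_adj_first hU hoff hn hhd
  have h1 : d ≠ m - 1 := by
    rintro rfl
    exact F.hanging_not_adj_last hU hoff hn hhd
  have h2 := F.gap_le' hU hoff (by omega) (i := d) (j := 0) (by omega) hd hhd F.v_first
  have h3 := F.gap_le hU hoff (by omega) (i := d) (j := m - 1) (by omega) (by omega) hhd F.v_last
  omega

lemma card_idx_hanging_succ_le (F : TwinFrame G m p u v) (hU : PathOn G U n h u)
    (hoff : Off m p v U) (hh : Off m p v {h}) (hn : 2 ≤ n) {d : ℕ} (hd : d < m)
    (hhd : G.Adj h (p d)) :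
    (idx G m p (p (d + 1))).card + (idx G m p h).card + (idx G m p v).card ≤ m + 1 := by
  have hm := F.two_le
  have hdb := F.index_bounds_of_hanging hU hoff hn hd hhd
  set A := (idx G m p h).image (· + 1) with hA
  set J := ((idx G m p v).erase d).erase (m - 1) with hJ
  set C := J.image (· + 2) with hC
  have hgap : ∀ i ∈ idx G m p h, ∀ j ∈ idx G m p v, i = j ∨ i + 3 ≤ j ∨ j + 3 ≤ i := by
    intro i hi j hj
    rw [mem_idx] at hi hj
    rcases lt_trichotomy i j with hij | hij | hij
    · have := F.gap_le hU hoff (by omega) hij hj.1 hi.2 hj.2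
      omega
    · exact Or.inl hij
    · have := F.gap_le' hU hoff (by omega) hij hi.1 hi.2 hj.2
      omega
  have hAm : ∀ i ∈ idx G m p h, i + 4 ≤ m := fun i hi => by
    rw [mem_idx] at hi
    exact (F.index_bounds_of_hanging hU hoff hn hi.1 hi.2).2
  have hJm : ∀ s ∈ J, s ∈ idx G m p v ∧ s ≠ d ∧ s + 2 < m := fun s hs => by
    simp only [hJ, Finset.mem_erase] at hs
    obtain ⟨h1, h2, h3⟩ := hs
    refine ⟨h3, h2, ?_⟩
    rw [mem_idx] at h3
    have : s ≠ m - 2 := by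
      rintro rfl
      apply F.v_insert (by omega) h3.2
      rw [show m - 2 + 1 = m - 1 by omega]
      exact F.v_last
    omega
  have hcA : A.card = (idx G m p h).card := Finset.card_image_of_injective _ (add_left_injective 1)
  have hcC : C.card = J.card := Finset.card_image_of_injective _ (add_left_injective 2)
  have hcJ : (idx G m p v).card ≤ J.card + 2 := by
    have := Finset.pred_card_le_card_erase (s := idx G m p v) (a := d)
    have := Finset.pred_card_le_card_erase (s := (idx G m p v).erase d) (a := m - 1)
    rw [hJ]
    omega
  have hAC : Disjoint A C := by
    rw [Finset.disjoint_left]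
    intro x hx hx'
    simp only [hA, hC, Finset.mem_image] at hx hx'
    obtain ⟨i, hi, rfl⟩ := hx
    obtain ⟨s, hs, hs'⟩ := hx'
    have := hgap i hi s (hJm s hs).1
    have : s + 2 = i + 1 := hs'
    omega
  have h0 : 0 ∉ A ∪ C := by simp [hA, hC]
  have hx : Disjoint (idx G m p (p (d + 1))) (insert 0 (A ∪ C)) := by
    rw [Finset.disjoint_left]
    intro e he he'
    rw [mem_idx] at he
    rw [Finset.mem_insert, Finset.mem_union] at he'
    rcases he' with rfl | he' | he'
    · exact F.hanging_succ_not_adj_first hU hoff hn (by omega) hhd he.2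
    · simp only [hA, Finset.mem_image] at he'
      obtain ⟨j, hj, rfl⟩ := he'
      have hjm := hAm j hj
      rw [mem_idx] at hj
      rcases lt_trichotomy d j with hdj | rfl | hdj
      · exact F.hanging_succ_not_adj hh hdj (by omega) hhd hj.2 he.2
      · exact G.irrefl he.2
      · exact F.hanging_succ_not_adj hh hdj (by omega) hj.2 hhd he.2.symm
    · simp only [hC, Finset.mem_image] at he'
      obtain ⟨s, hs, rfl⟩ := he'
      obtain ⟨hs1, hs2, hs3⟩ := hJm s hs
      have := hgap d (by rw [mem_idx]; exact ⟨hd, hhd⟩) s hs1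
      rw [mem_idx] at hs1
      rcases lt_or_gt_of_ne hs2 with hsd | hsd
      · exact F.hanging_succ_not_adj_before hU hoff hn (by omega) (by omega) hhd hs1.2 he.2
      · exact F.hanging_succ_not_adj_after hU hoff hn hsd hs3 hhd hs1.2 he.2
  have hsub : idx G m p (p (d + 1)) ∪ insert 0 (A ∪ C) ⊆ Finset.range m := by
    intro e he
    simp only [Finset.mem_union, Finset.mem_insert, hA, hC, Finset.mem_image, mem_idx] at he
    rw [Finset.mem_range]
    rcases he with he | rfl | ⟨i, hi, rfl⟩ | ⟨s, hs, rfl⟩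
    · exact he.1
    · omega
    · have := hAm i (mem_idx.2 hi)
      omega
    · exact (hJm s hs).2.2
  have := Finset.card_le_card hsub
  rw [Finset.card_union_of_disjoint hx, Finset.card_insert_of_notMem h0,
    Finset.card_union_of_disjoint hAC, Finset.card_range] at this
  omega

variable [Fintype V]

lemma not_adj_of_hanging_of_sigma3 (F : TwinFrame G m p u v)
    (hsig : Fintype.card V ≤ sigma3 G) (hU : PathOn G U n h u) (hoff : Off m p v U)
    (hn : 2 ≤ n) (hh : Off m p v {h}) {K : Set V} (hUK : U ⊆ K) (hKv : ∀ r ∈ K, ¬ G.Adj r v)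
    (hKh : ∀ r, Off m p v {r} → G.Adj h r → r ∈ K) {d : ℕ} (hd : d < m) : ¬ G.Adj h (p d) := by
  intro hhd
  have hdb := F.index_bounds_of_hanging hU hoff hn hd hhd
  have hhv : ¬ G.Adj h v := F.not_adj_of_hanging hU hoff (by omega)
  have hhx : ¬ G.Adj h (p (d + 1)) := fun hx => by
    have := F.insert_le (PathOn.single G h) hh (by omega) hhd.symm hx
    omega
  have hvx : ¬ G.Adj v (p (d + 1)) := fun hx => by
    have := F.gap_le hU hoff (by omega) (i := d) (j := d + 1) (by omega) (by omega) hhd hx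
    omega
  have hne : h ≠ v := fun e => hh.1 e.symm
  have hnx : h ≠ p (d + 1) := fun e => hh.2 (d + 1) (by omega) e.symm
  have hsum := le_deg_add_deg_add_deg hsig hne hnx (F.ne_v (d + 1) (by omega)).symm hhv hhx hvx
  have hA := deg_le_card_add_card (m := m) (p := p) hhv
  have hB := deg_le_card_add_card (m := m) (p := p) (G.irrefl (v := v))
  have hC := deg_le_card_add_card (m := m) (p := p) (fun e => hvx e.symm)
  have hidx := F.card_idx_hanging_succ_le hU hoff hh hn hd hhd
  have hcard := F.card_offVerts_le
  have hhU : h ∈ U := by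
    obtain ⟨w, -, -, hw⟩ := hU
    exact (hw h).1 w.start_mem_support
  have d1 : Disjoint (offNbrs G m p v h) (offNbrs G m p v v) := by
    rw [Finset.disjoint_left]
    intro r hr hr'
    rw [mem_offNbrs] at hr hr'
    exact hKv r (hKh r hr.1 hr.2) hr'.2.symm
  have d2 : Disjoint (offNbrs G m p v h ∪ offNbrs G m p v v)
      (offNbrs G m p v (p (d + 1))) := by
    rw [Finset.disjoint_left]
    intro r hr hr'
    rw [Finset.mem_union, mem_offNbrs, mem_offNbrs] at hr
    rw [mem_offNbrs] at hr'
    rcases hr with hr | hr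
    · have hhr := hr.2
      have := F.insert_le ((PathOn.single G h).join hhr (PathOn.single G r) (by
        rintro z hz hz'
        rw [Set.mem_singleton_iff] at hz hz'
        exact hhr.ne (hz.symm.trans hz')))
        ⟨fun hm => hm.elim hh.1 hr.1.1, fun i hi hm => hm.elim (hh.2 i hi) (hr.1.2 i hi)⟩
        (by omega) hhd.symm hr'.2.symm
      omega
    · exact F.hanging_succ_no_common hU hoff hr.1 (fun hrU => hKv r (hUK hrU) hr.2.symm)
        (by omega) hhd hr.2 hr'.2
  have d3 : Disjoint (offNbrs G m p v h ∪ offNbrs G m p v v ∪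
      offNbrs G m p v (p (d + 1))) {h} := by
    rw [Finset.disjoint_singleton_right, Finset.mem_union, Finset.mem_union, mem_offNbrs,
      mem_offNbrs, mem_offNbrs]
    rintro ((hr | hr) | hr)
    · exact G.irrefl hr.2
    · exact hhv hr.2.symm
    · exact hhx hr.2.symm
  have hsub : offNbrs G m p v h ∪ offNbrs G m p v v ∪ offNbrs G m p v (p (d + 1)) ∪ {h} ⊆
      offVerts m p v := by
    intro r hr
    simp only [Finset.mem_union, mem_offNbrs, Finset.mem_singleton] at hr
    rw [mem_offVerts]
    rcases hr with ((hr | hr) | hr) | rfl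
    exacts [hr.1, hr.1, hr.1, hh]
  have := Finset.card_le_card hsub
  rw [Finset.card_union_of_disjoint d3, Finset.card_union_of_disjoint d2,
    Finset.card_union_of_disjoint d1, Finset.card_singleton] at this
  omega

lemma not_adj_off (F : TwinFrame G m p u v) (htough : OneTough G)
    (hsig : Fintype.card V ≤ sigma3 G) {w : V} (hw : Off m p v {w}) : ¬ G.Adj u w := by
  intro huw
  have hm := F.two_le
  set s : Set V := {r | Off m p v {r}} with hs
  have hus : u ∈ s := ⟨by simpa using F.ne.symm, fun i hi => by simpa using F.ne_u i hi⟩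
  set K : Set V := {x | ∃ hx : x ∈ s, (G.induce s).Reachable ⟨x, hx⟩ ⟨u, hus⟩} with hK
  have hoffs : ∀ U ⊆ s, Off m p v U := fun U hU =>
    ⟨fun hv => (hU hv).1 rfl, fun i hi hp => (hU hp).2 i hi rfl⟩
  have hpath : ∀ x ∈ K, ∃ U n, PathOn G U n x u ∧ (x ≠ u → 2 ≤ n) ∧ 1 ≤ n ∧ U ⊆ K := by
    rintro x ⟨hx, hr⟩
    obtain ⟨U, n, h1, h2, h3, h4⟩ := PathOn.exists_of_reachable_induce s _ _ hr
    exact ⟨U, n, h1, fun hne => h2 fun e => hne (congrArg Subtype.val e), h3, h4⟩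
  have hKs : K ⊆ s := fun x hx => hx.1
  have hKcl : ∀ x ∈ K, ∀ r ∈ s, G.Adj x r → r ∈ K := by
    rintro x ⟨hx, hr⟩ r hrs hxr
    exact ⟨hrs, .trans (SimpleGraph.Adj.reachable (by simpa using hxr.symm)) hr⟩
  have hKv : ∀ r ∈ K, ¬ G.Adj r v := fun r hr => by
    obtain ⟨U, n, h1, -, h3, h4⟩ := hpath r hr
    exact F.not_adj_of_hanging h1 (hoffs U (h4.trans hKs)) h3
  have huK : u ∈ K := ⟨hus, .rfl⟩
  have hwK : w ∈ K := hKcl u huK w hw huw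
  have hone := htough {u} ⟨u, rfl⟩
  rw [Set.ncard_singleton, Finite.card_le_one_iff_subsingleton] at hone
  have hreach : (G.induce {u}ᶜ).Reachable ⟨w, huw.ne.symm⟩ ⟨p 0, F.ne_u 0 (by omega)⟩ :=
    SimpleGraph.ConnectedComponent.exact (Subsingleton.elim _ _)
  obtain ⟨q⟩ := hreach
  obtain ⟨e, -, he1, he2⟩ := q.exists_boundary_dart {x | (x : V) ∈ K} hwK
    (fun h0 => (hKs h0).2 0 (by omega) rfl)
  have hadj : G.Adj (e.fst : V) (e.snd : V) := by simpa using e.adj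
  have hsnd : (e.snd : V) ∉ s := fun h => he2 (hKcl _ he1 _ h hadj)
  have : ∃ d < m, p d = (e.snd : V) := by
    by_contra hcon
    push Not at hcon
    refine hsnd ⟨?_, hcon⟩
    intro hv
    rw [Set.mem_singleton_iff] at hv
    exact hKv _ he1 (hv ▸ hadj)
  obtain ⟨d, hd, hdp⟩ := this
  obtain ⟨U, n, h1, h2, -, h4⟩ := hpath _ he1
  refine F.not_adj_of_hanging_of_sigma3 hsig h1 (hoffs U (h4.trans hKs)) (h2 e.fst.2)
    (hKs he1) h4 hKv (fun r hr hr' => hKcl _ he1 r hr hr') hd (hdp ▸ hadj)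

end order

section neighbours

lemma off_u (F : TwinFrame G m p u v) : Off m p v {u} :=
  ⟨by simpa using F.ne.symm, fun i hi => by simpa using F.ne_u i hi⟩

lemma off_swap {w : V} (hw : Off m p v {w}) (hwu : w ≠ u) : Off m p u {w} :=
  ⟨fun h => hwu (Eq.symm h), hw.2⟩

lemma off_rev {W : Set V} (hW : Off m p v W) : Off m (fun i => p (m - 1 - i)) v W :=
  ⟨hW.1, fun i hi => hW.2 _ (by omega)⟩

lemma not_adj_twin (F : TwinFrame G m p u v) : ¬ G.Adj u v :=
  F.not_adj_of_hanging (PathOn.single G u) F.off_u le_rfl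

lemma not_consecutive (F : TwinFrame G m p u v) {i : ℕ} (hi : i + 1 < m)
    (h : G.Adj u (p i) ∨ G.Adj v (p i)) : ¬ (G.Adj u (p (i + 1)) ∨ G.Adj v (p (i + 1))) := by
  rintro (h' | h') <;> rcases h with h | h
  · exact F.u_insert hi h h'
  · have := F.gap_le' (PathOn.single G u) F.off_u le_rfl (Nat.lt_succ_self i) hi h' h
    omega
  · have := F.gap_le (PathOn.single G u) F.off_u le_rfl (Nat.lt_succ_self i) hi h h'
    omega
  · exact F.v_insert hi h h'

lemma card_idx_le_of_adj_succ (F : TwinFrame G m p u v) {w : V} (hw : Off m p v {w})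
    (hwu : w ≠ u) {i : ℕ} (hi : i + 1 < m) (hui : G.Adj u (p i)) (hwi : G.Adj w (p (i + 1))) :
    (idx G m p u).card + (idx G m p v).card + (idx G m p w).card ≤ m + 2 := by
  have hm := F.two_le
  set I := idx G m p u ∪ idx G m p v with hI
  have hmemI : ∀ s, s ∈ I ↔ s < m ∧ (G.Adj u (p s) ∨ G.Adj v (p s)) := fun s => by
    simp only [hI, Finset.mem_union, mem_idx]
    tauto
  have hcons : ∀ s t, s ∈ I → t ∈ I → t ≠ s + 1 := by
    rintro s t hs ht rfl
    rw [hmemI] at hs ht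
    exact F.not_consecutive ht.1 hs.2 ht.2
  have hiI : i ∈ I := (hmemI i).2 ⟨by omega, Or.inl hui⟩
  have hlI : m - 1 ∈ I := (hmemI _).2 ⟨by omega, Or.inl F.u_last⟩
  have hlt : ∀ s ∈ I.erase (m - 1), s + 2 < m := fun s hs => by
    rw [Finset.mem_erase] at hs
    have := hcons s _ hs.2 hlI
    have := ((hmemI s).1 hs.2).1
    omega
  set A := ((I.erase (m - 1)).erase i).image (· + 1) with hA
  set C := (I.erase (m - 1)).image (· + 2) with hC
  have hcA : A.card + 2 = I.card := by
    rw [hA, Finset.card_image_of_injective _ (add_left_injective 1),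
      Finset.card_erase_of_mem (Finset.mem_erase.2 ⟨by omega, hiI⟩), Finset.card_erase_of_mem hlI]
    have := Finset.card_lt_card (Finset.erase_ssubset (Finset.mem_erase.2 ⟨by omega, hiI⟩ :
      i ∈ I.erase (m - 1)))
    rw [Finset.card_erase_of_mem hlI] at this
    omega
  have hcC : C.card + 1 = I.card := by
    rw [hC, Finset.card_image_of_injective _ (add_left_injective 2), Finset.card_erase_of_mem hlI]
    have := Finset.card_pos.2 ⟨_, hiI⟩
    omega
  have hAC : Disjoint A C := by
    rw [Finset.disjoint_left]
    intro x hx hx'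
    simp only [hA, hC, Finset.mem_image] at hx hx'
    obtain ⟨s, hs, rfl⟩ := hx
    obtain ⟨t, ht, ht'⟩ := hx'
    have ht' : t + 2 = s + 1 := ht'
    exact hcons t s (Finset.mem_of_mem_erase ht)
      (Finset.mem_of_mem_erase (Finset.mem_of_mem_erase hs)) (by omega)
  have h0 : 0 ∉ A ∪ C := by simp [hA, hC]
  have hkey : ∀ s ∈ I, s ≠ i → ∀ e, s < e → e ≤ s + 2 → e < m → (s < i → e ≤ i) →
      ¬ G.Adj w (p e) := by
    intro s hs hsi e h1 h2 h3 h4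
    rcases ((hmemI s).1 hs).2 with h | h
    · exact F.not_adj_succ_of_u hw hwu hi hui hwi h hsi h1 h2 h3 h4
    · exact F.not_adj_succ_of_v hw hwu hi hui hwi h hsi h1 h2 h3 h4
  have hx : Disjoint (idx G m p w) (insert 0 (A ∪ C)) := by
    rw [Finset.disjoint_left]
    intro e he he'
    rw [mem_idx] at he
    rw [Finset.mem_insert, Finset.mem_union] at he'
    rcases he' with rfl | he' | he'
    · exact F.not_adj_first_of_u hw hwu hi hui hwi he.2
    · simp only [hA, Finset.mem_image] at he'
      obtain ⟨s, hs, rfl⟩ := he'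
      rw [Finset.mem_erase] at hs
      exact hkey s (Finset.mem_of_mem_erase hs.2) hs.1 _ (by omega) (by omega) he.1
        (by omega) he.2
    · simp only [hC, Finset.mem_image] at he'
      obtain ⟨s, hs, rfl⟩ := he'
      by_cases hsi : s = i
      · subst hsi
        have := F.insert_le (PathOn.single G w) hw he.1 hwi.symm he.2
        omega
      · have := hcons s i (Finset.mem_of_mem_erase hs) hiI
        exact hkey s (Finset.mem_of_mem_erase hs) hsi _ (by omega) (by omega) he.1
          (by omega) he.2
  have hsub : idx G m p w ∪ insert 0 (A ∪ C) ⊆ Finset.range m := by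
    intro e he
    simp only [Finset.mem_union, Finset.mem_insert, hA, hC, Finset.mem_image, mem_idx] at he
    rw [Finset.mem_range]
    rcases he with he | rfl | ⟨s, hs, rfl⟩ | ⟨s, hs, rfl⟩
    · exact he.1
    · omega
    · have := hlt s (Finset.mem_of_mem_erase hs)
      omega
    · exact hlt s hs
  have hle := Finset.card_le_card hsub
  rw [Finset.card_union_of_disjoint hx, Finset.card_insert_of_notMem h0,
    Finset.card_union_of_disjoint hAC, Finset.card_range] at hle
  have h1 : (idx G m p u).card ≤ I.card := Finset.card_le_card Finset.subset_union_left
  have h2 : (idx G m p v).card ≤ I.card := Finset.card_le_card Finset.subset_union_right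
  omega

variable [Fintype V]

lemma not_adj_off_of_twin (F : TwinFrame G m p u v) (htough : OneTough G)
    (hsig : Fintype.card V ≤ sigma3 G) {w : V} (hw : Off m p v {w}) : ¬ G.Adj v w := by
  by_cases hwu : w = u
  · rw [hwu]
    exact fun h => F.not_adj_twin h.symm
  · exact F.swap.not_adj_off htough hsig (off_swap hw hwu)

lemma not_adj_succ_of_adj (F : TwinFrame G m p u v) (htough : OneTough G)
    (hsig : Fintype.card V ≤ sigma3 G) {w : V} (hw : Off m p v {w}) (hwu : w ≠ u) {i : ℕ}
    (hi : i + 1 < m) (hui : G.Adj u (p i)) : ¬ G.Adj w (p (i + 1)) := by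
  intro hwi
  have hnu : offNbrs G m p v u = ∅ := Finset.eq_empty_of_forall_notMem fun r hr => by
    rw [mem_offNbrs] at hr
    exact F.not_adj_off htough hsig hr.1 hr.2
  have hnv : offNbrs G m p v v = ∅ := Finset.eq_empty_of_forall_notMem fun r hr => by
    rw [mem_offNbrs] at hr
    exact F.not_adj_off_of_twin htough hsig hr.1 hr.2
  have hwv : ¬ G.Adj w v := fun h => F.not_adj_off_of_twin htough hsig hw h.symm
  have huw := F.not_adj_off htough hsig hw
  have hsum := le_deg_add_deg_add_deg hsig F.ne hwu.symm (fun e => hw.1 e) F.not_adj_twin huw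
    (fun h => hwv h.symm)
  have hA := deg_le_card_add_card (m := m) (p := p) F.not_adj_twin
  have hB := deg_le_card_add_card (m := m) (p := p) (G.irrefl (v := v))
  have hC := deg_le_card_add_card (m := m) (p := p) hwv
  rw [hnu, Finset.card_empty] at hA
  rw [hnv, Finset.card_empty] at hB
  have hidx := F.card_idx_le_of_adj_succ hw hwu hi hui hwi
  have hcard := F.card_offVerts_le
  have hd : Disjoint (offNbrs G m p v w) {u, w} := by
    rw [Finset.disjoint_left]
    intro r hr hr'
    rw [mem_offNbrs] at hr
    rw [Finset.mem_insert, Finset.mem_singleton] at hr'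
    rcases hr' with rfl | rfl
    · exact huw hr.2.symm
    · exact G.irrefl hr.2
  have hsub : offNbrs G m p v w ∪ {u, w} ⊆ offVerts m p v := by
    intro r hr
    simp only [Finset.mem_union, mem_offNbrs, Finset.mem_singleton, Finset.mem_insert] at hr
    rw [mem_offVerts]
    rcases hr with hr | rfl | rfl
    exacts [hr.1, F.off_u, hw]
  have := Finset.card_le_card hsub
  rw [Finset.card_union_of_disjoint hd, Finset.card_pair hwu.symm] at this
  omega

lemma not_adj_succ_of_mem (F : TwinFrame G m p u v) (htough : OneTough G)
    (hsig : Fintype.card V ≤ sigma3 G) {w : V} (hw : Off m p v {w}) (hwu : w ≠ u) {i : ℕ}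
    (hi : i + 1 < m) (h : G.Adj u (p i) ∨ G.Adj v (p i)) : ¬ G.Adj w (p (i + 1)) := by
  rcases h with h | h
  · exact F.not_adj_succ_of_adj htough hsig hw hwu hi h
  · exact F.swap.not_adj_succ_of_adj htough hsig (off_swap hw hwu) (fun e => hw.1 e.symm) hi h

lemma not_adj_pred_of_mem (F : TwinFrame G m p u v) (htough : OneTough G)
    (hsig : Fintype.card V ≤ sigma3 G) {w : V} (hw : Off m p v {w}) (hwu : w ≠ u) {i : ℕ}
    (hi : i + 1 < m) (h : G.Adj u (p (i + 1)) ∨ G.Adj v (p (i + 1))) : ¬ G.Adj w (p i) := by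
  have := F.rev.not_adj_succ_of_mem htough hsig (off_rev hw) hwu (i := m - 1 - (i + 1)) (by omega)
    (by rwa [show m - 1 - (m - 1 - (i + 1)) = i + 1 by omega])
  rwa [show m - 1 - (m - 1 - (i + 1) + 1) = i by omega] at this

end neighbours

section tough

/-- The index of the last neighbour of `u` or `v` among `p 0, …, p j`. -/
def lastNbr (G : SimpleGraph V) (p : ℕ → V) (u v : V) (j : ℕ) : ℕ :=
  Nat.findGreatest (fun i => G.Adj u (p i) ∨ G.Adj v (p i)) j

lemma lastNbr_succ {i : ℕ} (h : G.Adj u (p i) ∨ G.Adj v (p i))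
    (h' : ¬ (G.Adj u (p (i + 1)) ∨ G.Adj v (p (i + 1)))) : lastNbr G p u v (i + 1) = i := by
  rw [lastNbr, Nat.findGreatest_of_not h']
  exact Nat.findGreatest_eq h

/-- A labelling of the vertices that is constant on the components left after removing the
neighbours of `u` and `v`. -/
def label (G : SimpleGraph V) (m : ℕ) (p : ℕ → V) (u v : V) (i₀ : ℕ) (x : V) : Option ℕ :=
  if x = u then none else if x = v then some (m - 1) else
    if h : ∃ j < m, p j = x then some (lastNbr G p u v h.choose) else some i₀

lemma label_path (F : TwinFrame G m p u v) (i₀ : ℕ) {j : ℕ} (hj : j < m) :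
    label G m p u v i₀ (p j) = some (lastNbr G p u v j) := by
  have h : ∃ k < m, p k = p j := ⟨j, hj, rfl⟩
  rw [label, if_neg (F.ne_u j hj), if_neg (F.ne_v j hj), dif_pos h,
    F.inj _ h.choose_spec.1 _ hj h.choose_spec.2]

lemma label_off {i₀ : ℕ} {w : V} (hw : Off m p v {w}) (hwu : w ≠ u) :
    label G m p u v i₀ w = some i₀ := by
  rw [label, if_neg hwu, if_neg fun h => hw.1 h.symm, dif_neg]
  rintro ⟨j, hj, h⟩
  exact hw.2 j hj h

variable [Fintype V]

lemma label_eq_of_adj (F : TwinFrame G m p u v) (htough : OneTough G)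
    (hsig : Fintype.card V ≤ sigma3 G) {i₀ : ℕ}
    (hdisc : ∀ j < m, ∀ k < m, ¬ (G.Adj u (p j) ∨ G.Adj v (p j)) →
      ¬ (G.Adj u (p k) ∨ G.Adj v (p k)) → lastNbr G p u v j ≠ lastNbr G p u v k →
      ¬ G.Adj (p j) (p k))
    (hlong : ∀ j, j + 2 < m → ¬ (G.Adj u (p j) ∨ G.Adj v (p j)) →
      ¬ (G.Adj u (p (j + 1)) ∨ G.Adj v (p (j + 1))) →
      ¬ (G.Adj u (p (j + 2)) ∨ G.Adj v (p (j + 2))) → lastNbr G p u v (j + 1) = i₀)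
    {x y : V} (hx : ¬ (G.Adj u x ∨ G.Adj v x)) (hy : ¬ (G.Adj u y ∨ G.Adj v y))
    (hxy : G.Adj x y) : label G m p u v i₀ x = label G m p u v i₀ y := by
  have hm := F.two_le
  have hcases : ∀ z, ¬ (G.Adj u z ∨ G.Adj v z) → (∃ z', G.Adj z z' ∧
      ¬ (G.Adj u z' ∨ G.Adj v z')) → (∃ j < m, p j = z) ∨ (Off m p v {z} ∧ z ≠ u) := by
    rintro z - ⟨z', hzz', hz'⟩
    by_cases h : ∃ j < m, p j = z
    · exact Or.inl h
    · push Not at h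
      refine Or.inr ⟨⟨?_, h⟩, ?_⟩
      · rintro rfl
        exact hz' (Or.inr hzz')
      · rintro rfl
        exact hz' (Or.inl hzz')
  have hmix : ∀ j < m, ¬ (G.Adj u (p j) ∨ G.Adj v (p j)) → ∀ w, Off m p v {w} → w ≠ u →
      G.Adj w (p j) → lastNbr G p u v j = i₀ := by
    intro j hj hnj w hw hwu hwj
    have h0 : j ≠ 0 := by
      rintro rfl
      exact hnj (Or.inl F.u_first)
    have h1 : j ≠ m - 1 := by
      rintro rfl
      exact hnj (Or.inl F.u_last)
    obtain ⟨k, rfl⟩ := Nat.exists_eq_succ_of_ne_zero h0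
    exact hlong k (by omega)
      (fun h => F.not_adj_succ_of_mem htough hsig hw hwu hj h hwj) hnj
      (fun h => F.not_adj_pred_of_mem htough hsig hw hwu (i := k + 1) (by omega) h hwj)
  rcases hcases x hx ⟨y, hxy, hy⟩ with ⟨j, hj, rfl⟩ | ⟨hxo, hxu⟩ <;>
    rcases hcases y hy ⟨_, hxy.symm, hx⟩ with ⟨k, hk, rfl⟩ | ⟨hyo, hyu⟩
  · rw [F.label_path i₀ hj, F.label_path i₀ hk]
    by_contra hne
    exact hdisc j hj k hk hx hy (fun h => hne (congrArg some h)) hxy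
  · rw [F.label_path i₀ hj, label_off hyo hyu, hmix j hj hx y hyo hyu hxy.symm]
  · rw [F.label_path i₀ hk, label_off hxo hxu, hmix k hk hy x hxo hxu hxy]
  · rw [label_off hxo hxu, label_off hyo hyu]

lemma exists_long (F : TwinFrame G m p u v) (htough : OneTough G)
    (hsig : Fintype.card V ≤ sigma3 G) (i₀ : ℕ)
    (hdisc : ∀ j < m, ∀ k < m, ¬ (G.Adj u (p j) ∨ G.Adj v (p j)) →
      ¬ (G.Adj u (p k) ∨ G.Adj v (p k)) → lastNbr G p u v j ≠ lastNbr G p u v k →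
      ¬ G.Adj (p j) (p k)) :
    ∃ j, j + 2 < m ∧ ¬ (G.Adj u (p j) ∨ G.Adj v (p j)) ∧
      ¬ (G.Adj u (p (j + 1)) ∨ G.Adj v (p (j + 1))) ∧
      ¬ (G.Adj u (p (j + 2)) ∨ G.Adj v (p (j + 2))) ∧ lastNbr G p u v (j + 1) ≠ i₀ := by
  by_contra hcon
  have hm := F.two_le
  set S : Set V := {x | G.Adj u x ∨ G.Adj v x} with hS
  set I := idx G m p u ∪ idx G m p v with hI
  have hmemI : ∀ s, s ∈ I ↔ s < m ∧ (G.Adj u (p s) ∨ G.Adj v (p s)) := fun s => by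
    simp only [hI, Finset.mem_union, mem_idx]
    tauto
  have hSI : S.ncard ≤ I.card := by
    have : S ⊆ (I.image p : Finset V) := by
      intro x hx
      simp only [Finset.coe_image, Set.mem_image, Finset.mem_coe, hmemI]
      by_contra h
      have hoff : Off m p v {x} := by
        refine ⟨?_, fun i hi hix => h ⟨i, ⟨hi, ?_⟩, hix⟩⟩
        · rintro rfl
          exact hx.elim F.not_adj_twin (G.irrefl)
        · rw [Set.mem_singleton_iff] at hix
          rw [hix]
          exact hx
      exact hx.elim (F.not_adj_off htough hsig hoff) (F.not_adj_off_of_twin htough hsig hoff)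
    exact (Set.ncard_le_ncard this (Finset.finite_toSet _)).trans
      ((Set.ncard_coe_finset _).trans_le Finset.card_image_le)
  have hadj : ∀ x y : ↑Sᶜ, (G.induce Sᶜ).Adj x y →
      label G m p u v i₀ x = label G m p u v i₀ y := fun x y hxy => by
    refine F.label_eq_of_adj htough hsig hdisc ?_ x.2 y.2 (by simpa using hxy)
    intro j h1 h2 h3 h4
    by_contra h5
    exact hcon ⟨j, h1, h2, h3, h4, h5⟩
  have hwalk : ∀ (x y : ↑Sᶜ) (q : (G.induce Sᶜ).Walk x y),
      label G m p u v i₀ x = label G m p u v i₀ y := by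
    intro x y q
    induction q with
    | nil => rfl
    | cons h _ ih => exact (hadj _ _ h).trans ih
  set g : (G.induce Sᶜ).ConnectedComponent → Option ℕ :=
    SimpleGraph.ConnectedComponent.lift (fun x : ↑Sᶜ => label G m p u v i₀ x)
      (fun x y q _ => hwalk x y q) with hg
  have hmk : ∀ x : ↑Sᶜ, label G m p u v i₀ x ∈ Set.range g := fun x =>
    ⟨(G.induce Sᶜ).connectedComponentMk x, rfl⟩
  have hsub : (insert none (I.image some) : Finset (Option ℕ)) ⊆ (Set.range g).toFinset := by
    intro y hy
    rw [Finset.mem_insert, Finset.mem_image] at hy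
    rw [Set.mem_toFinset]
    rcases hy with rfl | ⟨i, hi, rfl⟩
    · have := hmk ⟨u, fun h => h.elim G.irrefl fun h => F.not_adj_twin h.symm⟩
      rwa [label, if_pos rfl] at this
    · rw [hmemI] at hi
      by_cases him : i + 1 < m
      · have hn := F.not_consecutive him hi.2
        have := hmk ⟨p (i + 1), hn⟩
        rwa [F.label_path i₀ him, lastNbr_succ hi.2 hn] at this
      · have := hmk ⟨v, fun h => h.elim F.not_adj_twin G.irrefl⟩
        rwa [label, if_neg F.ne.symm, if_pos rfl, show m - 1 = i by omega] at this
  have h1 := Finset.card_le_card hsub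
  rw [Finset.card_insert_of_notMem (by simp),
    Finset.card_image_of_injective _ (Option.some_injective _), ← Set.ncard_eq_toFinset_card',
    ← Nat.card_coe_set_eq] at h1
  have h2 := Finite.card_range_le g
  have h3 := htough S ⟨p 0, Or.inl F.u_first⟩
  omega

end tough

end TwinFrame

open Walk in
lemma exists_cycle_enum {G : SimpleGraph V} [DecidableEq V] {a : V} {c : G.Walk a a}
    (hc : c.IsCycle) {v : V} (hv : v ∈ c.support) :
    ∃ q : ℕ → V, q 0 = v ∧ q c.length = v ∧
      (∀ i < c.length, ∀ j < c.length, q i = q j → i = j) ∧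
      (∀ i, G.Adj (q i) (q (i + 1))) ∧ (∀ i, q i ∈ c.support) ∧
      (∀ i, cSucc c (q i) = q (i + 1)) ∧ cPred c v = q (c.length - 1) := by
  have hlen : c.support.tail.length = c.length := by simp
  have h3 := hc.isCircuit.three_le_length
  have hvt : v ∈ c.support.tail := by
    rcases (mem_support_iff _).1 hv with rfl | h
    · exact end_mem_tail_support hc.not_nil
    · exact h
  obtain ⟨i₀, hi₀, hi₀v⟩ := List.getElem_of_mem hvt
  have hlt : ∀ j, (i₀ + j) % c.length < c.support.tail.length := fun j => by
    rw [hlen]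
    exact Nat.mod_lt _ (by omega)
  have hget : ∀ k (hk : k < c.support.tail.length), c.support.tail[k] = c.getVert (k + 1) := by
    intro k hk
    rw [List.getElem_tail, support_getElem_eq_getVert]
  set q : ℕ → V := fun j => c.support.tail[(i₀ + j) % c.length]'(hlt j) with hq
  have hq0 : q 0 = v := by
    simp only [hq, Nat.add_zero, ← hi₀v]
    congr 1
    exact Nat.mod_eq_of_lt (hlen ▸ hi₀)
  have hqN : q c.length = v := by
    rw [← hq0]
    simp only [hq, Nat.add_zero, Nat.add_mod_right]
  have hmod : ∀ j, ((i₀ + j) % c.length + 1) % c.length = (i₀ + (j + 1)) % c.length := by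
    intro j
    rw [Nat.mod_add_mod, Nat.add_assoc]
  have hmem : ∀ j, q j ∈ c.support.tail := fun j => List.getElem_mem _
  have hnext : ∀ j, c.support.tail.next (q j) (hmem j) = q (j + 1) := by
    intro j
    rw [List.next_getElem _ hc.support_nodup]
    simp only [hlen, hmod, hq]
  refine ⟨q, hq0, hqN, ?_, ?_, fun i => List.mem_of_mem_tail (hmem i), ?_, ?_⟩
  · intro i hi j hj h
    have := (List.Nodup.getElem_inj_iff hc.support_nodup).1 h
    have := Nat.ModEq.add_left_cancel' i₀ this
    exact Nat.ModEq.eq_of_lt_of_lt this hi hj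
  · intro i
    simp only [hq, hget, ← hmod i]
    have hl := hlt i
    rw [hlen] at hl
    by_cases h : (i₀ + i) % c.length + 1 < c.length
    · rw [Nat.mod_eq_of_lt h]
      exact c.adj_getVert_succ h
    · rw [show (i₀ + i) % c.length + 1 = c.length by omega, Nat.mod_self, getVert_length]
      simpa using c.adj_getVert_succ (i := 0) (by omega)
  · intro i
    rw [cSucc, dif_pos (hmem i), hnext]
  · have hN : q (c.length - 1 + 1) = v := by
      rw [← hqN]
      congr 1
      omega
    have := List.prev_next _ hc.support_nodup _ (hmem (c.length - 1))
    rw [cPred, dif_pos hvt, ← this]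
    congr 1
    rw [hnext, hN]

lemma exists_twinFrame {G : SimpleGraph V} [DecidableEq V] {a : V} {c : G.Walk a a}
    (hc : IsLongestCycle G c) {u v : V} (hu : u ∉ c.support) (hv : v ∈ c.support)
    (huv1 : G.Adj u (cSucc c v)) (huv2 : G.Adj u (cPred c v)) :
    ∃ m p, TwinFrame G m p u v ∧ ∀ i, cSucc c (p i) = p (i + 1) := by
  obtain ⟨q, hq0, hqN, hinj, hadj, hmem, hsucc, hpred⟩ := exists_cycle_enum hc.1 hv
  have h3 := hc.1.isCircuit.three_le_length
  have hl : c.length - 1 - 1 + 1 = c.length - 1 := by omega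
  refine ⟨c.length - 1, fun i => q (i + 1), ⟨by omega, ?_, fun i _ => hadj _, ?_, ?_, ?_, ?_, ?_,
    ?_, ?_, ?_⟩, fun i => hsucc _⟩
  · intro i hi j hj h
    have := hinj _ (by omega) _ (by omega) h
    omega
  · rintro rfl
    exact hu hv
  · intro i _ h
    exact hu (h ▸ hmem _)
  · intro i hi h
    have := hinj _ (by omega) _ (by omega) (h.trans hq0.symm)
    omega
  · rwa [← hq0, hsucc] at huv1
  · rwa [hpred, ← hl] at huv2
  · rw [← hq0]
    exact hadj 0
  · have := hadj (c.length - 1)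
    rw [show c.length - 1 + 1 = c.length by omega, hqN] at this
    simp only [hl]
    exact this.symm
  · intro S n x y h hyx hn
    obtain ⟨w, hw, hwn⟩ := h.exists_isCycle hyx hn
    have := hc.2 _ w hw
    omega

lemma lt_intervalLen {G : SimpleGraph V} [DecidableEq V] {a : V} {c : G.Walk a a} {B : Set V}
    {b : V} {d k : ℕ} (hB : ∀ i, 0 < i → i ≤ d → (cSucc c)^[i] b ∉ B) (hk : 0 < k)
    (hkB : (cSucc c)^[k] b ∈ B) : d < intervalLen c B b := by
  obtain ⟨h1, h2⟩ := Nat.sInf_mem (s := {k | 0 < k ∧ (cSucc c)^[k] b ∈ B}) ⟨k, hk, hkB⟩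
  by_contra h
  exact hB _ h1 (not_lt.1 h) h2

namespace TwinFrame

variable {G : SimpleGraph V} {m : ℕ} {p : ℕ → V} {u v : V}

lemma lastNbr_spec (F : TwinFrame G m p u v) {j : ℕ} (hj : ¬ (G.Adj u (p j) ∨ G.Adj v (p j))) :
    lastNbr G p u v j < j ∧
      (G.Adj u (p (lastNbr G p u v j)) ∨ G.Adj v (p (lastNbr G p u v j))) ∧
      ∀ k, lastNbr G p u v j < k → k ≤ j → ¬ (G.Adj u (p k) ∨ G.Adj v (p k)) := by
  have h := Nat.findGreatest_spec (P := fun i => G.Adj u (p i) ∨ G.Adj v (p i)) (Nat.zero_le j)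
    (Or.inl F.u_first)
  have hle : lastNbr G p u v j ≤ j := Nat.findGreatest_le j
  refine ⟨lt_of_le_of_ne hle fun e => hj ?_, h, fun k hk hkj =>
    Nat.findGreatest_is_greatest hk hkj⟩
  rw [← e]
  exact h

section intervals

variable [DecidableEq V] {a : V} {c : G.Walk a a} {B : Set V}

lemma iterate_cSucc (hp : ∀ i, cSucc c (p i) = p (i + 1)) (i k : ℕ) :
    (cSucc c)^[k] (p i) = p (i + k) := by
  induction k with
  | zero => rfl
  | succ k ih => rw [Function.iterate_succ_apply', ih, hp, Nat.add_assoc]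

lemma lt_intervalLen_lastNbr (F : TwinFrame G m p u v)
    (hp : ∀ i, cSucc c (p i) = p (i + 1)) (hB : B = G.neighborSet u ∪ G.neighborSet v)
    {j d : ℕ} (hj : j < m) (hnj : ¬ (G.Adj u (p j) ∨ G.Adj v (p j)))
    (hd : ∀ k, j < k → k ≤ lastNbr G p u v j + d → ¬ (G.Adj u (p k) ∨ G.Adj v (p k))) :
    d < intervalLen c B (p (lastNbr G p u v j)) := by
  obtain ⟨h1, -, h3⟩ := F.lastNbr_spec hnj
  have hmem : ∀ k, p k ∈ B ↔ G.Adj u (p k) ∨ G.Adj v (p k) := fun k => by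
    rw [hB]
    exact Iff.rfl
  refine lt_intervalLen (k := m - 1 - lastNbr G p u v j) (fun i hi hid => ?_) ?_ ?_
  · rw [iterate_cSucc hp, hmem]
    rcases Nat.lt_or_ge j (lastNbr G p u v j + i) with h | h
    · exact hd _ h (by omega)
    · exact h3 _ (by omega) h
  · omega
  · rw [iterate_cSucc hp, hmem, Nat.add_sub_cancel' (by omega)]
    exact Or.inl F.u_last

lemma mem_innerVerts_lastNbr (F : TwinFrame G m p u v)
    (hp : ∀ i, cSucc c (p i) = p (i + 1)) (hB : B = G.neighborSet u ∪ G.neighborSet v)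
    {j : ℕ} (hj : j < m) (hnj : ¬ (G.Adj u (p j) ∨ G.Adj v (p j))) :
    p j ∈ innerVerts c B (p (lastNbr G p u v j)) := by
  have h := (F.lastNbr_spec hnj).1
  refine ⟨j - lastNbr G p u v j, by omega,
    F.lt_intervalLen_lastNbr hp hB hj hnj fun k h1 h2 => by omega, ?_⟩
  rw [iterate_cSucc hp, Nat.add_sub_cancel' h.le]

end intervals

end TwinFrame

theorem stmt7 {V : Type*} [Fintype V] [DecidableEq V] (G : SimpleGraph V)
    (hn : 3 ≤ Fintype.card V) (htough : OneTough G) (hsig : Fintype.card V ≤ sigma3 G)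
    (hham : ¬ G.IsHamiltonian) {a : V} (c : G.Walk a a) (hc : IsLongestCycle G c)
    (u v : V) (hu : u ∉ c.support) (hv : v ∈ c.support)
    (huv1 : G.Adj u (cSucc c v)) (huv2 : G.Adj u (cPred c v))
    (B : Set V) (hB : B = G.neighborSet u ∪ G.neighborSet v)
    (hdisc : ∀ b₁ ∈ B, ∀ b₂ ∈ B, b₁ ≠ b₂ →
      ∀ x ∈ innerVerts c B b₁, ∀ y ∈ innerVerts c B b₂, ¬ G.Adj x y) :
    ∃ b₁ ∈ B, ∃ b₂ ∈ B, b₁ ≠ b₂ ∧ 3 < intervalLen c B b₁ ∧ 3 < intervalLen c B b₂ := by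
  obtain ⟨m, p, F, hp⟩ := exists_twinFrame hc hu hv huv1 huv2
  have hmem : ∀ k, p k ∈ B ↔ G.Adj u (p k) ∨ G.Adj v (p k) := fun k => by
    rw [hB]
    exact Iff.rfl
  have hdisc' : ∀ j < m, ∀ k < m, ¬ (G.Adj u (p j) ∨ G.Adj v (p j)) →
      ¬ (G.Adj u (p k) ∨ G.Adj v (p k)) →
      TwinFrame.lastNbr G p u v j ≠ TwinFrame.lastNbr G p u v k → ¬ G.Adj (p j) (p k) := by
    intro j hj k hk hnj hnk hne
    obtain ⟨h1, h2, -⟩ := F.lastNbr_spec hnj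
    obtain ⟨h3, h4, -⟩ := F.lastNbr_spec hnk
    exact hdisc _ ((hmem _).2 h2) _ ((hmem _).2 h4)
      (fun h => hne (F.inj _ (by omega) _ (by omega) h)) _
      (F.mem_innerVerts_lastNbr hp hB hj hnj) _ (F.mem_innerVerts_lastNbr hp hB hk hnk)
  have hlen : ∀ j, j + 2 < m → ¬ (G.Adj u (p j) ∨ G.Adj v (p j)) →
      ¬ (G.Adj u (p (j + 1)) ∨ G.Adj v (p (j + 1))) →
      ¬ (G.Adj u (p (j + 2)) ∨ G.Adj v (p (j + 2))) →
      3 < intervalLen c B (p (TwinFrame.lastNbr G p u v (j + 1))) := by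
    intro j hj h0 h1 h2
    refine F.lt_intervalLen_lastNbr hp hB (by omega) h1 fun k hk hk' => ?_
    obtain ⟨h3, h4, -⟩ := F.lastNbr_spec h1
    have : TwinFrame.lastNbr G p u v (j + 1) ≠ j := fun h => h0 (h ▸ h4)
    rwa [show k = j + 2 by omega]
  obtain ⟨j, hj, hj0, hj1, hj2, -⟩ := F.exists_long htough hsig m hdisc'
  obtain ⟨k, hk, hk0, hk1, hk2, hne⟩ :=
    F.exists_long htough hsig (TwinFrame.lastNbr G p u v (j + 1)) hdisc'
  obtain ⟨h1, h2, -⟩ := F.lastNbr_spec hj1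
  obtain ⟨h3, h4, -⟩ := F.lastNbr_spec hk1
  exact ⟨_, (hmem _).2 h4, _, (hmem _).2 h2,
    fun h => hne (F.inj _ (by omega) _ (by omega) h), hlen k hk hk0 hk1 hk2,
    hlen j hj hj0 hj1 hj2⟩

end
end Paper
end

section
/- (Hopping Lemma, Woodall) Let C be a cycle of length m in a graph G with no cycle of length m+1 and no cycle C' of length m with fewer components in G−V(C') than in G−V(C), and let u be an isolated vertex of G−V(C). Define Y₀ = ∅ and for i ≥ 1: X_i = N(Y_{i−1} ∪ {u}), Y_i = (X_i ∩ V(C))⁺ ∩ (X_i ∩ V(C))⁻. Let X = ∪X_i, Y = ∪Y_i. Then: (a) X ⊆ V(C); (b) no two vertices of X are consecutive on C; (c) X ∩ Y = ∅; (d) Y is an independent set. -/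
open scoped Classical

namespace Paper

noncomputable section

variable {V : Type*}

/-- the sets `Y_i` of Woodall's Hopping Lemma -/
def hopY {V : Type*} [DecidableEq V] (G : SimpleGraph V) {a : V} (c : G.Walk a a)
    (u : V) : ℕ → Set V
  | 0 => ∅
  | (i + 1) =>
      (cSucc c '' (nbhdSet G (hopY G c u i ∪ {u}) ∩ {x | x ∈ c.support})) ∩
      (cPred c '' (nbhdSet G (hopY G c u i ∪ {u}) ∩ {x | x ∈ c.support}))

/-- A nonempty list of distinct vertices tracing a path of `G` from `a` to `b`. -/
structure IsPathList (G : SimpleGraph V) (l : List V) (a b : V) : Prop where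
  nodup : l.Nodup
  chain : l.IsChain G.Adj
  head : l.head? = some a
  last : l.getLast? = some b

/-- The list `l` passes through `z` along `f z, z, g z`, in one of the two directions. -/
def Straight (f g : V → V) (l : List V) (z : V) : Prop :=
  [f z, z, g z] <:+: l ∨ [g z, z, f z] <:+: l

theorem IsPathList.reverse {G : SimpleGraph V} {l : List V} {a b : V} (h : IsPathList G l a b) :
    IsPathList G l.reverse b a where
  nodup := List.nodup_reverse.2 h.nodup
  chain := by
    rw [List.isChain_reverse]
    exact h.chain.imp fun _ _ hab => hab.symm
  head := by simpa using h.last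
  last := by simpa using h.head

theorem Straight.reverse {f g : V → V} {l : List V} {z : V} (h : Straight f g l z) :
    Straight f g l.reverse z := by
  rcases h with h | h
  · exact Or.inr (by simpa using List.reverse_infix.2 h)
  · exact Or.inl (by simpa using List.reverse_infix.2 h)

theorem Straight.mono {f g : V → V} {l l' : List V} {z : V} (h : Straight f g l z)
    (hl : l <:+: l') : Straight f g l' z :=
  h.imp (fun h => h.trans hl) fun h => h.trans hl

theorem infix_or_infix_of_infix_append {L R : List V} {s z t : V} (h : [s, z, t] <:+: L ++ R)
    (hL : L.getLast? ≠ some z) (hR : R.head? ≠ some z) :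
    [s, z, t] <:+: L ∨ [s, z, t] <:+: R := by
  obtain ⟨p, q, h⟩ := h
  rw [List.append_assoc, List.append_eq_append_iff] at h
  rcases h with ⟨d, rfl, h⟩ | ⟨d, rfl, h⟩
  · rcases d with _ | ⟨d1, _ | ⟨d2, _ | ⟨d3, d⟩⟩⟩
    · exact Or.inr ⟨[], q, by simpa using h⟩
    · simp only [List.cons_append, List.nil_append, List.cons.injEq] at h
      exact absurd (by simp [← h.2]) hR
    · simp only [List.cons_append, List.nil_append, List.cons.injEq] at h
      exact absurd (by simp [← h.2.1]) hL
    · simp only [List.cons_append, List.nil_append, List.cons.injEq] at h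
      obtain ⟨rfl, rfl, rfl, h⟩ := h
      exact Or.inl ⟨p, d, by simp⟩
  · exact Or.inr ⟨d, q, by simp [h]⟩

theorem Straight.of_append {f g : V → V} {L R : List V} {z : V} (h : Straight f g (L ++ R) z)
    (hL : L.getLast? ≠ some z) (hR : R.head? ≠ some z) :
    Straight f g L z ∨ Straight f g R z := by
  rcases h with h | h
  · exact (infix_or_infix_of_infix_append h hL hR).imp Or.inl Or.inl
  · exact (infix_or_infix_of_infix_append h hL hR).imp Or.inr Or.inr

theorem Straight.reverse_append {f g : V → V} {L R : List V} {z : V}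
    (h : Straight f g (L ++ R) z) (hL : L.getLast? ≠ some z) (hR : R.head? ≠ some z) :
    Straight f g (L.reverse ++ R) z :=
  (h.of_append hL hR).elim (fun h => h.reverse.mono List.infix_append_left)
    fun h => h.mono List.infix_append_right

/-- Rotating a path: if the first vertex is adjacent to the vertex `y` of the path, the initial
segment before `y` may be reversed. -/
theorem IsPathList.rotate {G : SimpleGraph V} {p q : List V} {a b x y : V}
    (h : IsPathList G (p ++ [x] ++ y :: q) a b) (hay : G.Adj a y) :
    IsPathList G ((p ++ [x]).reverse ++ y :: q) x b where
  nodup := ((List.reverse_perm _).append_right _).nodup_iff.2 h.nodup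
  chain := by
    obtain ⟨h1, h2, -⟩ := List.isChain_append.1 h.chain
    refine List.isChain_append.2 ⟨?_, h2, ?_⟩
    · rw [List.isChain_reverse]
      exact h1.imp fun _ _ hab => hab.symm
    · intro v hv w hw
      have ha := h.head
      rw [List.head?_append_of_ne_nil _ (by simp)] at ha
      rw [List.getLast?_reverse, ha] at hv
      simp only [Option.mem_def, Option.some.injEq, List.head?_cons] at hv hw
      exact hv ▸ hw ▸ hay
  head := by simp
  last := by
    have := h.last
    rw [List.getLast?_append_of_ne_nil _ (by simp)] at this ⊢
    exact this

/-- One round of rotations at both ends of a path. -/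
theorem IsPathList.exists_ends_mem {G : SimpleGraph V} {f g : V → V} {X Y Y₀ : Set V}
    {l : List V} {a b : V} (h : IsPathList G l a b)
    (hf : ∀ y ∈ Y, f y ∈ X) (hg : ∀ y ∈ Y, g y ∈ X) (hXY : Disjoint X Y) (hY : Y₀ ⊆ Y)
    (hY₀ : ∀ y ∈ Y₀, ∀ x, G.Adj y x → x ∈ X)
    (ha : a ∈ X ∨ ∃ y ∈ Y, G.Adj y a) (hb : b ∈ X ∨ ∃ y ∈ Y, G.Adj y b)
    (hl : ∀ y ∈ Y, Straight f g l y) :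
    ∃ l' a' b', l'.Perm l ∧ IsPathList G l' a' b' ∧ a' ∈ X ∧ b' ∈ X ∧
      ∀ y ∈ Y₀, Straight f g l' y := by
  have key : ∀ {l : List V} {a b y : V}, IsPathList G l a b → G.Adj y a → a ∉ X → y ∈ Y →
      Straight f g l y → ∃ x x' p q, x ∈ X ∧ x' ∈ X ∧ l = p ++ [x] ++ y :: x' :: q := by
    intro l a b y _ _ _ hy hs
    rcases hs with ⟨p, q, h⟩ | ⟨p, q, h⟩
    · exact ⟨f y, g y, p, q, hf y hy, hg y hy, by simp [← h]⟩
    · exact ⟨g y, f y, p, q, hg y hy, hf y hy, by simp [← h]⟩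
  have step : ∀ {p q : List V} {x y z : V}, x ∈ X → z ∈ Y → z ≠ y →
      Straight f g (p ++ [x] ++ y :: q) z → Straight f g ((p ++ [x]).reverse ++ y :: q) z := by
    intro p q x y z hx hz hzy hs
    refine hs.reverse_append ?_ ?_
    · simp only [List.getLast?_append, List.getLast?_singleton, Option.some_or, ne_eq,
        Option.some.injEq]
      rintro rfl
      exact Set.disjoint_left.1 hXY hx hz
    · simpa using hzy.symm
  have notY₀ : ∀ {a y : V}, a ∉ X → G.Adj y a → ∀ z ∈ Y₀, z ≠ y := by
    rintro a y ha hya z hz rfl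
    exact ha (hY₀ _ hz _ hya)
  have one : ∀ {l : List V} {a b : V}, IsPathList G l a b → (∀ y ∈ Y, Straight f g l y) →
      a ∉ X → (∃ y ∈ Y, G.Adj y a) → b ∈ X →
      ∃ l' a' b', l'.Perm l ∧ IsPathList G l' a' b' ∧ a' ∈ X ∧ b' ∈ X ∧
        ∀ y ∈ Y₀, Straight f g l' y := by
    rintro l a b h hl haX ⟨y, hy, hya⟩ hb
    obtain ⟨x, x', p, q, hx, -, rfl⟩ := key h hya haX hy (hl y hy)
    exact ⟨_, _, _, (List.reverse_perm _).append_right _, h.rotate hya.symm, hx, hb,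
      fun z hz => step hx (hY hz) (notY₀ haX hya z hz) (hl z (hY hz))⟩
  by_cases haX : a ∈ X
  · by_cases hbX : b ∈ X
    · exact ⟨l, a, b, .refl _, h, haX, hbX, fun z hz => hl z (hY hz)⟩
    · obtain ⟨l', a', b', hp, h'⟩ := one h.reverse (fun y hy => (hl y hy).reverse) hbX
        (hb.resolve_left hbX) haX
      exact ⟨l', a', b', hp.trans (List.reverse_perm _), h'⟩
  by_cases hbX : b ∈ X
  · exact one h hl haX (ha.resolve_left haX) hbX
  obtain ⟨y, hy, hya⟩ := ha.resolve_left haX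
  obtain ⟨w, hw, hwb⟩ := hb.resolve_left hbX
  obtain ⟨x, x', p, q, hx, hx', rfl⟩ := key h hya haX hy (hl y hy)
  have h₁ := (h.rotate hya.symm).reverse
  have hs : ∀ z ∈ Y, z ≠ y → Straight f g ((p ++ [x]).reverse ++ y :: x' :: q).reverse z :=
    fun z hz hzy => (step hx hz hzy (hl z hz)).reverse
  have hperm : ((p ++ [x]).reverse ++ y :: x' :: q).reverse.Perm (p ++ [x] ++ y :: x' :: q) :=
    (List.reverse_perm _).trans ((List.reverse_perm _).append_right _)
  obtain ⟨v, r, t, hv, hrt⟩ : ∃ v r t, v ∈ X ∧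
      ((p ++ [x]).reverse ++ y :: x' :: q).reverse = r ++ [v] ++ w :: t := by
    by_cases hwy : w = y
    · exact ⟨x', q.reverse, p ++ [x], hx', by simp [hwy]⟩
    · obtain ⟨v, v', r, t, hv, -, hrt⟩ := key h₁ hwb hbX hw (hs w hw hwy)
      exact ⟨v, r, v' :: t, hv, hrt⟩
  rw [hrt] at h₁ hperm hs
  exact ⟨_, _, _, ((List.reverse_perm _).append_right _).trans hperm, h₁.rotate hwb.symm, hv, hx,
    fun z hz => step hv (hY hz) (notY₀ hbX hwb z hz)
      (hs z (hY hz) (notY₀ haX hya z hz))⟩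

/-- A path with at least two vertices whose ends are adjacent to an outside vertex `u` closes up
to a cycle through `u`. -/
theorem IsPathList.exists_isCycle {G : SimpleGraph V} {l : List V} {a b u : V}
    (h : IsPathList G l a b) (hl : 2 ≤ l.length) (hu : u ∉ l) (ha : G.Adj u a) (hb : G.Adj u b) :
    ∃ w : G.Walk u u, w.IsCycle ∧ w.length = l.length + 1 ∧ ∀ x, x ∈ w.support ↔ x = u ∨ x ∈ l := by
  obtain ⟨w, hw⟩ : ∃ w : G.Walk a b, w.support = l := by
    have hne : l ≠ [] := by rintro rfl; simp at hl
    have h1 : l.head hne = a := by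
      have := h.head; rwa [List.head?_eq_some_head hne, Option.some.injEq] at this
    have h2 : l.getLast hne = b := by
      have := h.last; rwa [List.getLast?_eq_some_getLast hne, Option.some.injEq] at this
    subst h1 h2
    exact ⟨.ofSupport l hne h.chain, SimpleGraph.Walk.support_ofSupport ..⟩
  have hlen : w.length + 1 = l.length := by rw [← hw, SimpleGraph.Walk.length_support]
  refine ⟨.cons ha (w.concat hb.symm), ?_, ?_, ?_⟩
  · rw [SimpleGraph.Walk.cons_isCycle_iff]
    refine ⟨?_, ?_⟩
    · rw [SimpleGraph.Walk.isPath_def, SimpleGraph.Walk.support_concat, hw]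
      exact List.nodup_append.2 ⟨h.nodup, by simp, by rintro x hx y hy rfl; simp_all⟩
    · rw [SimpleGraph.Walk.edges_concat, List.concat_eq_append, List.mem_append, List.mem_singleton]
      rintro (he | he)
      · exact hu (hw ▸ w.fst_mem_support_of_mem_edges he)
      · have hab : a = b := by
          rw [Sym2.eq_iff] at he
          rcases he with ⟨-, rfl⟩ | ⟨-, rfl⟩
          · exact absurd rfl ha.ne
          · rfl
        subst hab
        have : w.IsPath := by rw [SimpleGraph.Walk.isPath_def, hw]; exact h.nodup
        rw [SimpleGraph.Walk.isPath_iff_nil, ← SimpleGraph.Walk.length_eq_zero_iff] at this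
        omega
  · simp [← hlen]
  · intro x
    simp [SimpleGraph.Walk.support_concat, hw]
    tauto

/-- Exchanging the isolated vertex `u` outside `S` for a vertex of `S` with a neighbour outside `S`
lowers the number of components outside. -/
theorem card_connectedComponent_exchange_lt [Finite V] {G : SimpleGraph V} {S S' : Set V}
    {u v w : V} (hu : u ∉ S) (hiso : ∀ x, G.Adj u x → x ∈ S) (hv : v ∈ S) (hw : w ∉ S)
    (hvw : G.Adj v w) (hwu : w ≠ u) (hS' : ∀ x, x ∈ S' ↔ x = u ∨ x ∈ S ∧ x ≠ v) :
    Nat.card (G.induce S'ᶜ).ConnectedComponent < Nat.card (G.induce Sᶜ).ConnectedComponent := by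
  have hvS' : v ∈ S'ᶜ := by
    intro h
    rcases (hS' v).1 h with rfl | h
    · exact hu hv
    · exact h.2 rfl
  have hmem : ∀ x, x ∉ S → x ≠ u → x ∈ S'ᶜ := by
    intro x hx hxu h
    rcases (hS' x).1 h with h | h
    · exact hxu h
    · exact hx h.1
  let φ : G.induce Sᶜ →g G.induce S'ᶜ :=
    { toFun := fun x => if h : (x : V) = u then ⟨v, hvS'⟩ else ⟨x, hmem x x.2 h⟩
      map_rel' := by
        rintro ⟨x, hx⟩ ⟨y, hy⟩ hxy
        have hxy' : G.Adj x y := hxy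
        have hxu : x ≠ u := by rintro rfl; exact hy (hiso _ hxy')
        have hyu : y ≠ u := by rintro rfl; exact hx (hiso _ hxy'.symm)
        simpa [hxu, hyu] using hxy' }
  have hφu : φ ⟨u, hu⟩ = ⟨v, hvS'⟩ := dif_pos rfl
  have hφ : ∀ x (hx : x ∉ S) (hxu : x ≠ u), φ ⟨x, hx⟩ = ⟨x, hmem x hx hxu⟩ :=
    fun x hx hxu => dif_neg hxu
  have hsurj : Function.Surjective (SimpleGraph.ConnectedComponent.map φ) := by
    intro K
    induction K using SimpleGraph.ConnectedComponent.ind with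
    | h x =>
      obtain ⟨x, hx⟩ := x
      by_cases hxv : x = v
      · subst hxv
        exact ⟨SimpleGraph.connectedComponentMk _ ⟨u, hu⟩, by simp [hφu]⟩
      · have hxu : x ≠ u := fun h => hx ((hS' x).2 (Or.inl h))
        have hxS : x ∉ S := fun h => hx ((hS' x).2 (Or.inr ⟨h, hxv⟩))
        exact ⟨SimpleGraph.connectedComponentMk _ ⟨x, hxS⟩, by simp [hφ x hxS hxu]⟩
  have hinj : ¬ Function.Injective (SimpleGraph.ConnectedComponent.map φ) := by
    intro hinj
    have heq : (G.induce Sᶜ).connectedComponentMk ⟨u, hu⟩ =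
        (G.induce Sᶜ).connectedComponentMk ⟨w, hw⟩ := by
      apply hinj
      simp only [SimpleGraph.ConnectedComponent.map_mk, hφu, hφ w hw hwu]
      exact SimpleGraph.ConnectedComponent.connectedComponentMk_eq_of_adj hvw
    obtain ⟨p⟩ := SimpleGraph.ConnectedComponent.exact heq
    cases p with
    | nil => exact hwu rfl
    | cons hadj _ => exact Subtype.prop (p := (· ∈ Sᶜ)) _ (hiso _ hadj)
  have := Fintype.ofFinite (G.induce Sᶜ).ConnectedComponent
  have := Fintype.ofFinite (G.induce S'ᶜ).ConnectedComponent
  rw [Nat.card_eq_fintype_card, Nat.card_eq_fintype_card]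
  exact Fintype.card_lt_of_surjective_not_injective _ hsurj hinj

theorem mem_support_tail {G : SimpleGraph V} {a : V} {c : G.Walk a a} (hc : c.IsCycle)
    {x : V} : x ∈ c.support.tail ↔ x ∈ c.support := by
  refine ⟨List.mem_of_mem_tail, fun h => ?_⟩
  rcases (SimpleGraph.Walk.mem_support_iff c).1 h with rfl | h
  · exact SimpleGraph.Walk.end_mem_tail_support hc.not_nil
  · exact h

theorem nbhdSet_mono {G : SimpleGraph V} {S T : Set V} (h : S ⊆ T) :
    nbhdSet G S ⊆ nbhdSet G T :=
  fun _ ⟨y, hy, hyz⟩ => ⟨y, h hy, hyz⟩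

section Cycle

variable [DecidableEq V] {G : SimpleGraph V} {a : V} {c : G.Walk a a}

theorem cSucc_eq_and_cPred_eq {l : List V} {x y : V} (hc : c.IsCycle) (hl : l ~r c.support.tail)
    (h : [x, y] <:+: l) : cSucc c x = y ∧ cPred c y = x := by
  obtain ⟨p, q, rfl⟩ := h
  have hr : (x :: y :: (q ++ p)) ~r c.support.tail := by
    refine List.IsRotated.trans ?_ hl
    rw [List.append_assoc]
    simpa using (List.isRotated_append (l := p) (l' := [x, y] ++ q)).symm
  have hn : (x :: y :: (q ++ p)).Nodup := hr.nodup_iff.2 hc.support_nodup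
  have hx : x ∈ c.support.tail := hr.mem_iff.1 (by simp)
  have hy : y ∈ c.support.tail := hr.mem_iff.1 (by simp)
  have hyx : y ≠ x := by rintro rfl; simp at hn
  rw [cSucc, dif_pos hx, cPred, dif_pos hy, ← List.isRotated_next_eq hr hn (by simp),
    ← List.isRotated_prev_eq hr hn (by simp)]
  exact ⟨List.next_cons_cons_eq _ _ _ _, List.prev_cons_cons_of_ne _ _ _ _ hyx⟩

theorem straight_of_isRotated {l : List V} {z : V} (hc : c.IsCycle) (hl : l ~r c.support.tail)
    (hz : z ∈ c.support) (h1 : l.head? ≠ some z) (h2 : l.getLast? ≠ some z) :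
    Straight (cPred c) (cSucc c) l z := by
  obtain ⟨p, q, rfl⟩ := List.append_of_mem (hl.mem_iff.2 ((mem_support_tail hc).2 hz))
  rcases List.eq_nil_or_concat p with rfl | ⟨p, s, rfl⟩
  · simp at h1
  rcases q with _ | ⟨t, q⟩
  · simp at h2
  have hs := (cSucc_eq_and_cPred_eq (x := s) (y := z) hc hl ⟨p, t :: q, by simp⟩).2
  have ht := (cSucc_eq_and_cPred_eq (x := z) (y := t) hc hl ⟨p ++ [s], q, by simp⟩).1
  exact Or.inl ⟨p, q, by simp [hs, ht]⟩

theorem cPred_cSucc (hc : c.IsCycle) {x : V} (hx : x ∈ c.support) : cPred c (cSucc c x) = x := by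
  have hx' := (mem_support_tail hc).2 hx
  rw [cSucc, dif_pos hx', cPred, dif_pos (List.next_mem _ _ _), List.prev_next _ hc.support_nodup]

theorem cSucc_cPred (hc : c.IsCycle) {x : V} (hx : x ∈ c.support) : cSucc c (cPred c x) = x := by
  have hx' := (mem_support_tail hc).2 hx
  rw [cPred, dif_pos hx', cSucc, dif_pos (List.prev_mem _ _ _), List.next_prev _ hc.support_nodup]

theorem cSucc_mem_support (hc : c.IsCycle) {x : V} (hx : x ∈ c.support) :
    cSucc c x ∈ c.support := by
  rw [cSucc, dif_pos ((mem_support_tail hc).2 hx)]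
  exact List.mem_of_mem_tail (List.next_mem _ _ _)

theorem cPred_mem_support (hc : c.IsCycle) {x : V} (hx : x ∈ c.support) :
    cPred c x ∈ c.support := by
  rw [cPred, dif_pos ((mem_support_tail hc).2 hx)]
  exact List.mem_of_mem_tail (List.prev_mem _ _ _)

/-- The cycle cut open just after `x`. -/
theorem exists_isPathList_cSucc (hc : c.IsCycle) {x : V} (hx : x ∈ c.support) :
    ∃ l, l ~r c.support.tail ∧ IsPathList G l (cSucc c x) x := by
  have hw : (c.rotate x hx).IsCycle := by simpa using hc
  have hl : (c.rotate x hx).support.tail ~r c.support.tail := SimpleGraph.Walk.support_rotate ..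
  have hne : (c.rotate x hx).support.tail ≠ [] := fun h => by
    have := (mem_support_tail hw).2 (SimpleGraph.Walk.start_mem_support _)
    simp [h] at this
  have hlast : (c.rotate x hx).support.tail.getLast? = some x := by
    rw [List.getLast?_eq_some_getLast hne, List.getLast_tail hne,
      SimpleGraph.Walk.getLast_support]
  refine ⟨_, hl, hw.support_nodup, (SimpleGraph.Walk.isChain_adj_support _).tail, ?_, hlast⟩
  have hlen : 3 ≤ (c.rotate x hx).support.tail.length := by simpa using hw.three_le_length
  generalize (c.rotate x hx).support.tail = l at *
  obtain ⟨p, rfl⟩ := List.getLast?_eq_some_iff.1 hlast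
  rcases p with _ | ⟨y, p⟩
  · simp at hlen
  have hr : (x :: y :: p) ~r c.support.tail :=
    (List.isRotated_append (l := [x]) (l' := y :: p)).trans hl
  rw [(cSucc_eq_and_cPred_eq (x := x) (y := y) hc hr ⟨[], p, rfl⟩).1]
  rfl

end Cycle

section Hopping

variable [DecidableEq V] {G : SimpleGraph V} {a : V} {c : G.Walk a a} {u : V}

theorem hopY_mono : Monotone (hopY G c u) := by
  refine monotone_nat_of_le_succ fun i => ?_
  induction i with
  | zero => exact Set.empty_subset _
  | succ i ih =>
    have := Set.inter_subset_inter_left {x | x ∈ c.support}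
      (nbhdSet_mono (G := G) (Set.union_subset_union_left {u} ih))
    exact Set.inter_subset_inter (Set.image_mono this) (Set.image_mono this)

theorem nbhdSet_hopY_mono : Monotone fun i => nbhdSet G (hopY G c u i ∪ {u}) :=
  fun _ _ h => nbhdSet_mono (Set.union_subset_union_left {u} (hopY_mono h))

theorem mem_hopY_succ (hc : c.IsCycle) {i : ℕ} {y : V} :
    y ∈ hopY G c u (i + 1) ↔ y ∈ c.support ∧ cPred c y ∈ nbhdSet G (hopY G c u i ∪ {u}) ∧
      cSucc c y ∈ nbhdSet G (hopY G c u i ∪ {u}) := by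
  constructor
  · rintro ⟨⟨x, ⟨hx, hxc⟩, rfl⟩, ⟨x', ⟨hx', hxc'⟩, h⟩⟩
    refine ⟨cSucc_mem_support hc hxc, by rwa [cPred_cSucc hc hxc], ?_⟩
    rwa [← h, cSucc_cPred hc hxc']
  · rintro ⟨hy, h1, h2⟩
    exact ⟨⟨_, ⟨h1, cPred_mem_support hc hy⟩, cSucc_cPred hc hy⟩,
      ⟨_, ⟨h2, cSucc_mem_support hc hy⟩, cPred_cSucc hc hy⟩⟩

theorem mem_support_of_mem_hopY (hc : c.IsCycle) {i : ℕ} {y : V} (hy : y ∈ hopY G c u i) :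
    y ∈ c.support :=
  ((mem_hopY_succ hc).1 (hopY_mono i.le_succ hy)).1

theorem mem_nbhdSet_hopY_zero {x : V} : x ∈ nbhdSet G (hopY G c u 0 ∪ {u}) ↔ G.Adj u x := by
  simp [nbhdSet, hopY]

/-- A path avoiding `u` with ends in `N(Y_i ∪ {u})`, running straight through `Y_i`, can be
transformed into a cycle through `u` and the vertices of the path. -/
theorem exists_isCycle_of_straight (hc : c.IsCycle) {i : ℕ}
    (hD : ∀ j < i, Disjoint (nbhdSet G (hopY G c u j ∪ {u})) (hopY G c u (j + 1)))
    {l : List V} {p q : V} (h : IsPathList G l p q) (hlen : 2 ≤ l.length) (hu : u ∉ l)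
    (hp : p ∈ nbhdSet G (hopY G c u i ∪ {u})) (hq : q ∈ nbhdSet G (hopY G c u i ∪ {u}))
    (hs : ∀ z ∈ hopY G c u i, Straight (cPred c) (cSucc c) l z) :
    ∃ w : G.Walk u u, w.IsCycle ∧ w.length = l.length + 1 ∧
      ∀ x, x ∈ w.support ↔ x = u ∨ x ∈ l := by
  induction i generalizing l p q with
  | zero =>
    exact h.exists_isCycle hlen hu (mem_nbhdSet_hopY_zero.1 hp) (mem_nbhdSet_hopY_zero.1 hq)
  | succ i ih =>
    have hor : ∀ x ∈ nbhdSet G (hopY G c u (i + 1) ∪ {u}),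
        x ∈ nbhdSet G (hopY G c u i ∪ {u}) ∨ ∃ y ∈ hopY G c u (i + 1), G.Adj y x := by
      rintro x ⟨y, hy | rfl, hyx⟩
      · exact Or.inr ⟨y, hy, hyx⟩
      · exact Or.inl ⟨_, Or.inr rfl, hyx⟩
    obtain ⟨l', p', q', hperm, h', hp', hq', hs'⟩ := h.exists_ends_mem
      (fun y hy => ((mem_hopY_succ hc).1 hy).2.1) (fun y hy => ((mem_hopY_succ hc).1 hy).2.2)
      (hD i i.lt_succ_self) (hopY_mono i.le_succ) (fun y hy x hyx => ⟨y, Or.inl hy, hyx⟩)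
      (hor p hp) (hor q hq) hs
    obtain ⟨w, hw, hwl, hws⟩ := ih (fun j hj => hD j (hj.trans i.lt_succ_self)) h'
      (hperm.length_eq ▸ hlen) (fun hu' => hu (hperm.mem_iff.1 hu')) hp' hq' hs'
    exact ⟨w, hw, hperm.length_eq ▸ hwl, fun x => by rw [hws, hperm.mem_iff]⟩

theorem not_straight_of_isPathList (hc : c.IsCycle)
    (h1 : ¬ ∃ (b : V) (w : G.Walk b b), w.IsCycle ∧ w.length = c.length + 1)
    (hu : u ∉ c.support) {i : ℕ}
    (hD : ∀ j < i, Disjoint (nbhdSet G (hopY G c u j ∪ {u})) (hopY G c u (j + 1)))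
    {l : List V} {p q : V} (hl : l.Perm c.support.tail) (h : IsPathList G l p q)
    (hp : p ∈ nbhdSet G (hopY G c u i ∪ {u})) (hq : q ∈ nbhdSet G (hopY G c u i ∪ {u})) :
    ¬ ∀ z ∈ hopY G c u i, Straight (cPred c) (cSucc c) l z := by
  intro hs
  have hlen : l.length = c.length := by rw [hl.length_eq]; simp
  have := hc.three_le_length
  obtain ⟨w, hw, hwl, -⟩ := exists_isCycle_of_straight hc hD h (by omega)
    (fun h => hu (List.mem_of_mem_tail (hl.mem_iff.1 h))) hp hq hs
  exact h1 ⟨u, w, hw, by omega⟩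

theorem cSucc_ne_of_mem_nbhdSet_hopY (hc : c.IsCycle)
    (h1 : ¬ ∃ (b : V) (w : G.Walk b b), w.IsCycle ∧ w.length = c.length + 1)
    (hu : u ∉ c.support) {i : ℕ}
    (hD : ∀ j < i, Disjoint (nbhdSet G (hopY G c u j ∪ {u})) (hopY G c u (j + 1)))
    (hE : Disjoint (nbhdSet G (hopY G c u i ∪ {u})) (hopY G c u i)) {x : V}
    (hxc : x ∈ c.support) (hx : x ∈ nbhdSet G (hopY G c u i ∪ {u})) :
    cSucc c x ∉ nbhdSet G (hopY G c u i ∪ {u}) := by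
  intro hx'
  obtain ⟨l, hl, h⟩ := exists_isPathList_cSucc hc hxc
  refine not_straight_of_isPathList hc h1 hu hD hl.perm h hx' hx fun z hz =>
    straight_of_isRotated hc hl (mem_support_of_mem_hopY hc hz) ?_ ?_
  · rw [h.head, ne_eq, Option.some.injEq]
    rintro rfl
    exact Set.disjoint_left.1 hE hx' hz
  · rw [h.last, ne_eq, Option.some.injEq]
    rintro rfl
    exact Set.disjoint_left.1 hE hx hz

theorem isIndepSet_hopY_succ (hc : c.IsCycle)
    (h1 : ¬ ∃ (b : V) (w : G.Walk b b), w.IsCycle ∧ w.length = c.length + 1)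
    (hu : u ∉ c.support) {i : ℕ}
    (hD : ∀ j ≤ i, Disjoint (nbhdSet G (hopY G c u j ∪ {u})) (hopY G c u (j + 1))) :
    IsIndepSet G (hopY G c u (i + 1)) := by
  intro x hx y hy hxy
  have hdisj := Set.disjoint_left.1 (hD i le_rfl)
  obtain ⟨hxc, -, hx'⟩ := (mem_hopY_succ hc).1 hx
  obtain ⟨hyc, -, hy'⟩ := (mem_hopY_succ hc).1 hy
  obtain ⟨l, hl, h⟩ := exists_isPathList_cSucc hc hxc
  obtain ⟨p, q, rfl⟩ := List.append_of_mem (hl.mem_iff.2 ((mem_support_tail hc).2 hyc))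
  rcases q with _ | ⟨r, q⟩
  · have := h.last
    simp only [List.getLast?_append, List.getLast?_singleton, Option.some_or,
      Option.some.injEq] at this
    exact hxy.ne this.symm
  have hr : cSucc c y = r := (cSucc_eq_and_cPred_eq hc hl ⟨p, q, by simp⟩).1
  rw [hr] at hy'
  have hrev : (p ++ y :: r :: q).reverse = q.reverse ++ [r] ++ y :: p.reverse := by simp
  have hpath := h.reverse
  rw [hrev] at hpath
  refine not_straight_of_isPathList hc h1 hu (fun j hj => hD j hj.le) ?_ (hpath.rotate hxy) hy' hx'
    fun z hz => Straight.reverse_append ?_ ?_ ?_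
  · refine ((List.reverse_perm _).append_right _).trans ?_
    rw [← hrev]
    exact (List.reverse_perm _).trans hl.perm
  · rw [← hrev]
    refine (straight_of_isRotated hc hl (mem_support_of_mem_hopY hc hz) ?_ ?_).reverse
    · rw [h.head, ne_eq, Option.some.injEq]
      rintro rfl
      exact hdisj hx' (hopY_mono i.le_succ hz)
    · rw [h.last, ne_eq, Option.some.injEq]
      rintro rfl
      exact hdisj ⟨_, Or.inl hz, hxy⟩ hy
  · simp only [List.getLast?_append, List.getLast?_singleton, Option.some_or, ne_eq,
      Option.some.injEq]
    rintro rfl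
    exact hdisj hy' (hopY_mono i.le_succ hz)
  · simp only [List.head?_cons, ne_eq, Option.some.injEq]
    rintro rfl
    exact hdisj ⟨_, Or.inl hz, hxy.symm⟩ hx

theorem disjoint_nbhdSet_hopY_self (hc : c.IsCycle)
    (h1 : ¬ ∃ (b : V) (w : G.Walk b b), w.IsCycle ∧ w.length = c.length + 1)
    (hu : u ∉ c.support) {i : ℕ}
    (hD : ∀ j < i, Disjoint (nbhdSet G (hopY G c u j ∪ {u})) (hopY G c u (j + 1))) :
    Disjoint (nbhdSet G (hopY G c u i ∪ {u})) (hopY G c u i) := by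
  cases i with
  | zero => exact Set.disjoint_empty _
  | succ i =>
    rw [Set.disjoint_left]
    rintro x ⟨y, hy | rfl, hyx⟩ hx
    · exact isIndepSet_hopY_succ hc h1 hu (fun j hj => hD j (Nat.lt_succ_of_le hj)) y hy x hx hyx
    · exact Set.disjoint_left.1 (hD i i.lt_succ_self) ⟨_, Or.inr rfl, hyx⟩ hx

theorem disjoint_nbhdSet_hopY_succ (hc : c.IsCycle)
    (h1 : ¬ ∃ (b : V) (w : G.Walk b b), w.IsCycle ∧ w.length = c.length + 1)
    (hu : u ∉ c.support) (i : ℕ) :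
    Disjoint (nbhdSet G (hopY G c u i ∪ {u})) (hopY G c u (i + 1)) := by
  induction i using Nat.strong_induction_on with
  | h i hD =>
    rw [Set.disjoint_left]
    intro x hx hx'
    obtain ⟨hxc, -, hs⟩ := (mem_hopY_succ hc).1 hx'
    exact cSucc_ne_of_mem_nbhdSet_hopY hc h1 hu hD (disjoint_nbhdSet_hopY_self hc h1 hu hD)
      hxc hx hs

theorem nbhdSet_hopY_subset_support [Finite V] (hc : c.IsCycle)
    (h1 : ¬ ∃ (b : V) (w : G.Walk b b), w.IsCycle ∧ w.length = c.length + 1)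
    (h2 : ∀ (b : V) (w : G.Walk b b), w.IsCycle → w.length = c.length →
      ¬ Nat.card ((G.induce {x | x ∈ w.support}ᶜ).ConnectedComponent) <
        Nat.card ((G.induce {x | x ∈ c.support}ᶜ).ConnectedComponent))
    (hu : u ∉ c.support) (hiso : ∀ y : V, G.Adj u y → y ∈ c.support) (i : ℕ) :
    nbhdSet G (hopY G c u i ∪ {u}) ⊆ {x | x ∈ c.support} := by
  have hD := disjoint_nbhdSet_hopY_succ hc h1 hu
  induction i with
  | zero => exact fun x hx => hiso x (mem_nbhdSet_hopY_zero.1 hx)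
  | succ i ih =>
    rintro x ⟨y, hy | rfl, hyx⟩
    swap
    · exact hiso x hyx
    by_cases hyi : y ∈ hopY G c u i
    · exact ih ⟨y, Or.inl hyi, hyx⟩
    by_contra hxc
    obtain ⟨hyc, hp, hs⟩ := (mem_hopY_succ hc).1 hy
    have hdisj := Set.disjoint_left.1 (hD i)
    have hxu : x ≠ u := by
      rintro rfl
      exact hdisj ⟨_, Or.inr rfl, hyx.symm⟩ hy
    obtain ⟨l, hl, h⟩ := exists_isPathList_cSucc hc hyc
    obtain ⟨l, rfl⟩ := List.getLast?_eq_some_iff.1 h.last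
    have hlen : l.length + 1 = c.length := by simpa using hl.perm.length_eq
    have := hc.three_le_length
    have hne : l ≠ [] := by rintro rfl; simp at hlen; omega
    have hyl : y ∉ l := fun hyl => (List.nodup_append.1 h.nodup).2.2 y hyl y (by simp) rfl
    have hmem : ∀ z, z ∈ l ↔ z ∈ c.support ∧ z ≠ y := by
      intro z
      rw [← mem_support_tail hc, ← hl.mem_iff]
      simp only [List.mem_append, List.mem_singleton]
      constructor
      · exact fun hz => ⟨Or.inl hz, fun hzy => hyl (hzy ▸ hz)⟩
      · exact fun hz => hz.1.resolve_right hz.2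
    have hlast : l.getLast? = some (cPred c y) := by
      obtain ⟨k, r, rfl⟩ := (List.eq_nil_or_concat l).resolve_left hne
      have := (cSucc_eq_and_cPred_eq (x := r) (y := y) hc hl ⟨k, [], by simp⟩).2
      simp [this]
    have hpath : IsPathList G l (cSucc c y) (cPred c y) :=
      ⟨h.nodup.of_append_left, h.chain.left_of_append, by
        rw [← h.head, List.head?_append_of_ne_nil _ hne], hlast⟩
    obtain ⟨w, hw, hwl, hws⟩ := exists_isCycle_of_straight hc (fun j _ => hD j) hpath (by omega)
      (fun hul => hu ((hmem u).1 hul).1) hs hp fun z hz => by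
        have hz' := hopY_mono i.le_succ hz
        have hzy : z ≠ y := by rintro rfl; exact hyi hz
        refine ((straight_of_isRotated hc hl (mem_support_of_mem_hopY hc hz) ?_ ?_).of_append
          ?_ ?_).resolve_right ?_
        · rw [h.head, ne_eq, Option.some.injEq]
          rintro rfl
          exact hdisj hs hz'
        · rw [h.last, ne_eq, Option.some.injEq]
          exact hzy.symm
        · rw [hlast, ne_eq, Option.some.injEq]
          rintro rfl
          exact hdisj hp hz'
        · simpa using hzy.symm
        · rintro (h | h) <;> simpa using h.length_le
    refine h2 u w hw (by omega) (card_connectedComponent_exchange_lt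
      (S := {x | x ∈ c.support}) hu hiso hyc hxc hyx hxu fun z => ?_)
    rw [Set.mem_ofPred_eq, hws, hmem]
    rfl

end Hopping

theorem stmt11 {V : Type*} [Fintype V] [DecidableEq V] (G : SimpleGraph V)
    {a : V} (c : G.Walk a a) (hc : c.IsCycle)
    (h1 : ¬ ∃ (b : V) (w : G.Walk b b), w.IsCycle ∧ w.length = c.length + 1)
    (h2 : ∀ (b : V) (w : G.Walk b b), w.IsCycle → w.length = c.length →
      ¬ Nat.card ((G.induce {x | x ∈ w.support}ᶜ).ConnectedComponent) <
        Nat.card ((G.induce {x | x ∈ c.support}ᶜ).ConnectedComponent))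
    (u : V) (hu : u ∉ c.support) (hiso : ∀ y : V, G.Adj u y → y ∈ c.support)
    (X Y : Set V)
    (hX : X = ⋃ i : ℕ, nbhdSet G (hopY G c u i ∪ {u}))
    (hY : Y = ⋃ i : ℕ, hopY G c u i) :
    X ⊆ {x | x ∈ c.support} ∧
    (∀ x₁ ∈ X, ∀ x₂ ∈ X, cSucc c x₁ ≠ x₂) ∧
    X ∩ Y = ∅ ∧
    IsIndepSet G Y := by
  subst hX hY
  have hD := disjoint_nbhdSet_hopY_succ hc h1 hu
  have hsub := nbhdSet_hopY_subset_support hc h1 h2 hu hiso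
  refine ⟨Set.iUnion_subset hsub, ?_, ?_, ?_⟩
  · intro x₁ hx₁ x₂ hx₂ h
    obtain ⟨i, hi⟩ := Set.mem_iUnion.1 hx₁
    obtain ⟨j, hj⟩ := Set.mem_iUnion.1 hx₂
    subst h
    exact cSucc_ne_of_mem_nbhdSet_hopY hc h1 hu (fun k _ => hD k)
      (disjoint_nbhdSet_hopY_self hc h1 hu fun k _ => hD k) (hsub i hi)
      (nbhdSet_hopY_mono (le_max_left i j) hi) (nbhdSet_hopY_mono (le_max_right i j) hj)
  · rw [← Set.disjoint_iff_inter_eq_empty, Set.disjoint_left]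
    intro x hx hx'
    obtain ⟨i, hi⟩ := Set.mem_iUnion.1 hx
    obtain ⟨j, hj⟩ := Set.mem_iUnion.1 hx'
    exact Set.disjoint_left.1 (hD (max i j)) (nbhdSet_hopY_mono (le_max_left i j) hi)
      (hopY_mono ((le_max_right i j).trans (Nat.le_succ _)) hj)
  · intro x hx y hy
    obtain ⟨i, hi⟩ := Set.mem_iUnion.1 hx
    obtain ⟨j, hj⟩ := Set.mem_iUnion.1 hy
    exact isIndepSet_hopY_succ hc h1 hu (i := max i j) (fun k _ => hD k)
      x (hopY_mono ((le_max_left i j).trans (Nat.le_succ _)) hi)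
      y (hopY_mono ((le_max_right i j).trans (Nat.le_succ _)) hj)

end
end Paper
end

section
/- In the standard setup (non-hamiltonian 1-tough G, σ₃(G) ≥ n ≥ 3, longest cycle C, u off C, v on C with v⁺,v⁻ ∈ N(u), B = N(u)∪N(v)): if x is a vertex on C with x⁻x⁺ ∈ E(G) and x⁺⁺ ∈ B, then x is not adjacent to any vertex y ∈ B⁻ − {x⁻, x, x⁺}. -/
open scoped Classical

namespace Paper

noncomputable section

variable {V : Type*}

/-- A cyclic enumeration of period `N` of the vertices of a cycle. -/
structure IsCyclicEnum (G : SimpleGraph V) (N : ℕ) (f : ℕ → V) : Prop where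
  three_le : 3 ≤ N
  adj : ∀ i j, j = i + 1 → G.Adj (f i) (f j)
  periodic : ∀ i j, j = i + N → f j = f i
  ne : ∀ i j, i < j → j < i + N → f i ≠ f j

lemma IsCyclicEnum.eq_or_le_of_eq {G : SimpleGraph V} {N : ℕ} {f : ℕ → V}
    (hf : IsCyclicEnum G N f) (i j : ℕ) (h : f i = f j) : i = j ∨ i + N ≤ j ∨ j + N ≤ i := by
  have := hf.ne i j
  have := hf.ne j i
  grind

lemma IsCyclicEnum.exists_segment {G : SimpleGraph V} {N : ℕ} {f : ℕ → V}
    (hf : IsCyclicEnum G N f) (i j : ℕ) (hij : i ≤ j) (hjN : j < i + N) :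
    ∃ p : G.Walk (f i) (f j), p.length = j - i ∧
      (∀ z, z ∈ p.support ↔ ∃ k, i ≤ k ∧ k ≤ j ∧ z = f k) ∧ p.support.Nodup := by
  induction j, hij using Nat.le_induction with
  | base => exact ⟨.nil, by simp, by intro z; simp; grind, by simp⟩
  | succ j hij ih =>
    obtain ⟨p, hl, hs, hn⟩ := ih (by omega)
    refine ⟨p.concat (hf.adj j _ rfl), by simp [hl]; omega, ?_, ?_⟩
    · intro z
      simp only [SimpleGraph.Walk.support_concat, List.mem_append,
        List.mem_singleton, hs]
      grind
    · have := hf.ne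
      simp only [SimpleGraph.Walk.support_concat, List.nodup_append, hs]
      grind

/-- No cycle of `G` is longer than `N`, phrased by closing up a path. -/
def NoLongerCycle (G : SimpleGraph V) (N : ℕ) : Prop :=
  ∀ (a b : V) (p : G.Walk a b), G.Adj b a → N ≤ p.length → ¬ p.support.Nodup

/-- The path `p` followed by the edge `h` and the path `q`. -/
abbrev join {G : SimpleGraph V} {a b c d : V} (p : G.Walk a b) (h : G.Adj b c)
    (q : G.Walk c d) : G.Walk a d :=
  p.append (.cons h q)

lemma support_join {G : SimpleGraph V} {a b c d : V} (p : G.Walk a b) (h : G.Adj b c)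
    (q : G.Walk c d) : (join p h q).support = p.support ++ q.support := by
  simp [join, SimpleGraph.Walk.support_append]

lemma length_join {G : SimpleGraph V} {a b c d : V} (p : G.Walk a b) (h : G.Adj b c)
    (q : G.Walk c d) : (join p h q).length = p.length + q.length + 1 := by
  simp [join, Nat.add_assoc]

lemma NoLongerCycle.not_bad_path {G : SimpleGraph V} {N : ℕ} (hN : NoLongerCycle G N)
    {a b w w' u v : V} (p : G.Walk a w) (q : G.Walk w' b)
    (hwu : G.Adj u w) (hwu' : G.Adj u w') (hwv : G.Adj v w) (hwv' : G.Adj v w')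
    (huv : u ≠ v) (hp : p.support.Nodup) (hq : q.support.Nodup)
    (hpq : ∀ z ∈ p.support, z ∉ q.support)
    (hup : u ∉ p.support) (huq : u ∉ q.support) (hvp : v ∉ p.support) (hvq : v ∉ q.support)
    (ha : G.Adj u a ∨ G.Adj v a) (hb : G.Adj u b ∨ G.Adj v b)
    (hlen : N ≤ p.length + q.length + 3) : False := by
  wlog h : G.Adj u a generalizing u v
  · exact this hwv hwv' hwu hwu' huv.symm hvp hvq hup huq ha.symm hb.symm
      (ha.resolve_left h)
  rcases hb with hb | hb
  · refine hN _ _ (join p hwv.symm (join .nil hwv' (join q hb.symm .nil))) h ?_ ?_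
    · simp only [length_join, SimpleGraph.Walk.length_nil]; omega
    · simp only [support_join, SimpleGraph.Walk.support_nil, List.nodup_append]
      grind
  · refine hN _ _ (join p hwv.symm (join .nil hb (join q.reverse hwu'.symm .nil))) h ?_ ?_
    · simp only [length_join, SimpleGraph.Walk.length_nil, SimpleGraph.Walk.length_reverse]; omega
    · simp only [support_join, SimpleGraph.Walk.support_nil, List.nodup_append,
        SimpleGraph.Walk.support_reverse, List.nodup_reverse, List.mem_reverse]
      grind

lemma IsCyclicEnum.not_consecutive {G : SimpleGraph V} {N : ℕ} {f : ℕ → V}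
    (hf : IsCyclicEnum G N f) (hN : NoLongerCycle G N) {u : V} {k j : ℕ}
    (hu : ∀ i, u ≠ f i) (hkj : k + 1 < j) (hjk : j < k + N)
    (hpre : G.Adj u (f (j - 1))) (hsuc : G.Adj u (f (j + 1)))
    (h₀ : G.Adj u (f k) ∨ G.Adj (f j) (f k))
    (h₁ : G.Adj u (f (k + 1)) ∨ G.Adj (f j) (f (k + 1))) : False := by
  obtain ⟨p, hpl, hps, hpn⟩ := hf.exists_segment (k + 1) (j - 1) (by omega) (by omega)
  obtain ⟨q, hql, hqs, hqn⟩ := hf.exists_segment (j + 1) (k + N) (by omega) (by omega)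
  have hne := hf.ne
  rw [← hf.periodic k _ rfl] at h₀
  refine hN.not_bad_path p q hpre hsuc (hf.adj _ _ (by omega)).symm (hf.adj _ _ rfl)
    (hu j) hpn hqn ?_ ?_ ?_ ?_ ?_ h₁ h₀ (by omega) <;> simp only [hps, hqs] <;> grind

lemma IsCyclicEnum.not_adj_succ {G : SimpleGraph V} {N : ℕ} {f : ℕ → V}
    (hf : IsCyclicEnum G N f) (hN : NoLongerCycle G N) {u : V} {k : ℕ}
    (hu : ∀ i, u ≠ f i) (h₀ : G.Adj u (f k)) : ¬ G.Adj u (f (k + 1)) := by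
  intro h₁
  have := hf.three_le
  obtain ⟨p, hpl, hps, hpn⟩ := hf.exists_segment (k + 1) (k + N) (by omega) (by omega)
  rw [← hf.periodic k _ rfl] at h₀
  refine hN _ _ (join p h₀.symm .nil) h₁ ?_ ?_
  · simp only [length_join, SimpleGraph.Walk.length_nil]; omega
  · simp only [support_join, SimpleGraph.Walk.support_nil, List.nodup_append, hps]
    split_ands <;> grind

lemma IsCyclicEnum.not_adj_on {G : SimpleGraph V} {N : ℕ} {f : ℕ → V}
    (hf : IsCyclicEnum G N f) (hN : NoLongerCycle G N) {u : V} {j : ℕ}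
    (hu : ∀ i, u ≠ f i) (hj₂ : 2 ≤ j) (hjN : j ≤ N + 1)
    (hpre : G.Adj u (f (j - 1))) (hsuc : G.Adj u (f (j + 1)))
    (hchord : G.Adj (f (N + 1)) (f (N - 1)))
    (h₂ : G.Adj u (f 2) ∨ G.Adj (f j) (f 2)) {i : ℕ} (hi₂ : 2 ≤ i) (hiN : i + 1 < N)
    (hi : G.Adj u (f (i + 1)) ∨ G.Adj (f j) (f (i + 1))) : ¬ G.Adj (f i) (f N) := by
  intro hiadj
  have hne := hf.eq_or_le_of_eq
  have h3 := hf.three_le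
  have huj : ¬ G.Adj u (f j) := fun h => hf.not_adj_succ hN hu h hsuc
  have hj2 : j ≠ 2 := by rintro rfl; simp_all
  have hji : j ≠ i + 1 := by rintro rfl; simp_all
  have hxs := hf.adj N (N + 1) rfl
  obtain ⟨q, hql, hqs, hqn⟩ := hf.exists_segment (i + 1) (N - 1) (by omega) (by omega)
  obtain hcase | rfl | hcase | rfl | rfl | rfl : j < i ∨ j = i ∨ (i + 1 < j ∧ j + 1 < N) ∨
      j = N - 1 ∨ j = N ∨ j = N + 1 := by omega
  · obtain ⟨p, hpl, hps, hpn⟩ := hf.exists_segment 2 (j - 1) (by omega) (by omega)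
    obtain ⟨r, hrl, hrs, hrn⟩ := hf.exists_segment (j + 1) i (by omega) (by omega)
    refine hN.not_bad_path p
      (join r hiadj (join .nil hxs (join .nil hchord q.reverse)))
      hpre hsuc (hf.adj _ _ (by omega)).symm (hf.adj _ _ rfl) (hu j) hpn
      ?_ ?_ ?_ ?_ ?_ ?_ h₂ hi ?_
    rotate_right
    · simp only [length_join, SimpleGraph.Walk.length_nil, SimpleGraph.Walk.length_reverse]; omega
    all_goals
      simp only [support_join, SimpleGraph.Walk.support_nil, List.nodup_append,
        SimpleGraph.Walk.support_reverse, List.nodup_reverse, List.mem_reverse, List.mem_append,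
        List.mem_singleton, hps, hqs, hrs]
      split_ands <;> grind
  · rcases h₂ with h₂ | h₂
    · obtain ⟨p, hpl, hps, hpn⟩ := hf.exists_segment 2 j (by omega) (by omega)
      refine hN _ _ (join p hiadj (join .nil hxs (join .nil hchord
        (join q.reverse hsuc.symm .nil)))) h₂ ?_ ?_
      · simp only [length_join, SimpleGraph.Walk.length_nil, SimpleGraph.Walk.length_reverse]
        omega
      · simp only [support_join, SimpleGraph.Walk.support_nil, List.nodup_append,
          SimpleGraph.Walk.support_reverse, List.nodup_reverse, List.mem_reverse, List.mem_append,
          List.mem_singleton, hps, hqs]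
        split_ands <;> grind
    · obtain ⟨p, hpl, hps, hpn⟩ := hf.exists_segment 2 (j - 1) (by omega) (by omega)
      refine hN _ _ (join p hpre.symm (join .nil hsuc (join q hchord.symm
        (join .nil hxs.symm (join .nil hiadj.symm .nil))))) h₂ ?_ ?_
      · simp only [length_join, SimpleGraph.Walk.length_nil]
        omega
      · simp only [support_join, SimpleGraph.Walk.support_nil, List.nodup_append, List.mem_append,
          List.mem_singleton, hps, hqs]
        split_ands <;> grind
  · obtain ⟨p, hpl, hps, hpn⟩ := hf.exists_segment 2 i (by omega) (by omega)
    obtain ⟨r, hrl, hrs, hrn⟩ := hf.exists_segment (j + 1) (N - 1) (by omega) (by omega)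
    obtain ⟨s, hsl, hss, hsn⟩ := hf.exists_segment (i + 1) (j - 1) (by omega) (by omega)
    refine hN.not_bad_path (join p hiadj (join .nil hxs (join .nil hchord r.reverse))) s.reverse
      hsuc hpre (hf.adj _ _ rfl) (hf.adj _ _ (by omega)).symm (hu j)
      ?_ ?_ ?_ ?_ ?_ ?_ ?_ h₂ hi ?_
    rotate_right
    · simp only [length_join, SimpleGraph.Walk.length_nil, SimpleGraph.Walk.length_reverse]; omega
    all_goals
      simp only [support_join, SimpleGraph.Walk.support_nil, List.nodup_append,
        SimpleGraph.Walk.support_reverse, List.nodup_reverse, List.mem_reverse, List.mem_append,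
        List.mem_singleton, hps, hrs, hss]
      split_ands <;> grind
  · have e₁ := hf.periodic 2 (N + 2) (by omega)
    rw [← hf.periodic (N - 1) (N - 1 + N) rfl] at hchord h₂
    refine hf.not_consecutive hN (k := N + 1) (j := N - 1 + N) hu (by omega) (by omega) ?_ ?_
      (.inr hchord.symm) (by rwa [e₁])
    · rwa [hf.periodic (N - 1 - 1) _ (by omega)]
    · rwa [hf.periodic (N - 1 + 1) _ (by omega)]
  · exact hf.not_consecutive hN hu (by omega) (by omega) hpre hsuc (.inr hiadj.symm) hi
  · refine hf.not_consecutive hN (k := N - 1) (j := N + 1) hu (by omega) (by omega) hpre hsuc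
      (.inr hchord) (.inl ?_)
    rwa [Nat.sub_add_cancel (by omega)]

lemma IsCyclicEnum.not_adj_off {G : SimpleGraph V} {N : ℕ} {f : ℕ → V}
    (hf : IsCyclicEnum G N f) (hN : NoLongerCycle G N) {u : V} {j : ℕ}
    (hu : ∀ i, u ≠ f i) (hj₂ : 2 ≤ j) (hjN : j ≤ N + 1)
    (hpre : G.Adj u (f (j - 1))) (hsuc : G.Adj u (f (j + 1)))
    (hchord : G.Adj (f (N + 1)) (f (N - 1)))
    (h₂ : G.Adj u (f 2) ∨ G.Adj (f j) (f 2)) {y : V} (hyf : ∀ i, y ≠ f i)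
    (hy : G.Adj u y ∨ G.Adj (f j) y) : ¬ G.Adj y (f N) := by
  intro hyx
  have hne := hf.eq_or_le_of_eq
  have h3 := hf.three_le
  have huj : ¬ G.Adj u (f j) := fun h => hf.not_adj_succ hN hu h hsuc
  have hj2 : j ≠ 2 := by rintro rfl; simp_all
  have hyu : u ≠ y := by rintro rfl; simp_all [G.adj_comm]
  have hxs := hf.adj N (N + 1) rfl
  obtain ⟨q, hql, hqs, hqn⟩ := hf.exists_segment 2 (N - 1) (by omega) (by omega)
  have e₂ := hf.periodic 2 (N + 2) (by omega)
  obtain hcase | hcase | rfl | hcase : j + 1 < N ∨ j = N - 1 ∨ j = N ∨ j = N + 1 := by omega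
  · obtain ⟨p, hpl, hps, hpn⟩ := hf.exists_segment 2 (j - 1) (by omega) (by omega)
    obtain ⟨r, hrl, hrs, hrn⟩ := hf.exists_segment (j + 1) (N - 1) (by omega) (by omega)
    have hvpre := hf.adj (j - 1) j (by omega)
    have hvsuc := hf.adj j (j + 1) rfl
    rcases hy with hy | hy <;> rcases h₂ with h₂ | h₂
    · refine hN _ _ (join q hchord.symm (join .nil hxs.symm (join .nil hyx.symm
        (join .nil hy.symm .nil)))) h₂ ?_ ?_
      · simp only [length_join, SimpleGraph.Walk.length_nil]; omega
      · simp only [support_join, SimpleGraph.Walk.support_nil, List.nodup_append, List.mem_append,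
          List.mem_singleton, hqs]
        split_ands <;> grind
    · refine hN _ _ (join p hpre.symm (join .nil hy (join .nil hyx (join .nil hxs
        (join .nil hchord (join r.reverse hvsuc.symm .nil)))))) h₂ ?_ ?_
      · simp only [length_join, SimpleGraph.Walk.length_nil, SimpleGraph.Walk.length_reverse]
        omega
      · simp only [support_join, SimpleGraph.Walk.support_nil, List.nodup_append, List.mem_append,
          SimpleGraph.Walk.support_reverse, List.nodup_reverse, List.mem_reverse,
          List.mem_singleton, hps, hrs]
        split_ands <;> grind
    · refine hN _ _ (join p hvpre (join .nil hy (join .nil hyx (join .nil hxs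
        (join .nil hchord (join r.reverse hsuc.symm .nil)))))) h₂ ?_ ?_
      · simp only [length_join, SimpleGraph.Walk.length_nil, SimpleGraph.Walk.length_reverse]
        omega
      · simp only [support_join, SimpleGraph.Walk.support_nil, List.nodup_append, List.mem_append,
          SimpleGraph.Walk.support_reverse, List.nodup_reverse, List.mem_reverse,
          List.mem_singleton, hps, hrs]
        split_ands <;> grind
    · refine hN _ _ (join p hpre.symm (join .nil hsuc (join r hchord.symm
        (join .nil hxs.symm (join .nil hyx.symm (join .nil hy.symm .nil)))))) h₂ ?_ ?_
      · simp only [length_join, SimpleGraph.Walk.length_nil]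
        omega
      · simp only [support_join, SimpleGraph.Walk.support_nil, List.nodup_append, List.mem_append,
          List.mem_singleton, hps, hrs]
        split_ands <;> grind
  · obtain rfl : N = j + 1 := by omega
    rcases hy with hy | hy
    · obtain ⟨p, hpl, hps, hpn⟩ := hf.exists_segment (j + 1) (j + j) (by omega) (by omega)
      refine hN _ _ (join p (c := u) ?_ (join .nil hy .nil)) hyx ?_ ?_
      · rw [hf.periodic (j - 1) (j + j) (by omega)]
        exact hpre.symm
      · simp only [length_join, SimpleGraph.Walk.length_nil]; omega
      · simp only [support_join, SimpleGraph.Walk.support_nil, List.nodup_append, List.mem_append,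
          List.mem_singleton, hps]
        split_ands <;> grind
    · exact hf.not_adj_succ hN hyf hy.symm hyx
  · rcases hy with hy | hy
    · obtain ⟨p, hpl, hps, hpn⟩ := hf.exists_segment (j + 1) (j + j - 1) (by omega) (by omega)
      refine hN _ _ (join p (c := u) ?_ (join .nil hy (join .nil hyx .nil)))
        (hf.adj j _ rfl) ?_ ?_
      · rw [hf.periodic (j - 1) (j + j - 1) (by omega)]
        exact hpre.symm
      · simp only [length_join, SimpleGraph.Walk.length_nil]; omega
      · simp only [support_join, SimpleGraph.Walk.support_nil, List.nodup_append, List.mem_append,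
          List.mem_singleton, hps]
        split_ands <;> grind
    · rcases h₂ with h₂ | h₂
      · rw [← e₂] at h₂
        exact hf.not_adj_succ hN hu hsuc h₂
      · refine hN _ _ (join q hpre.symm (join .nil hsuc (join .nil hxs.symm .nil))) h₂ ?_ ?_
        · simp only [length_join, SimpleGraph.Walk.length_nil]; omega
        · simp only [support_join, SimpleGraph.Walk.support_nil, List.nodup_append,
            List.mem_append, List.mem_singleton, hqs]
          split_ands <;> grind
  · subst hcase
    rcases hy with hy | hy
    · rw [e₂] at hsuc
      refine hN _ _ (join q hchord.symm (join .nil hxs.symm (join .nil hyx.symm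
        (join .nil hy.symm .nil)))) hsuc ?_ ?_
      · simp only [length_join, SimpleGraph.Walk.length_nil]; omega
      · simp only [support_join, SimpleGraph.Walk.support_nil, List.nodup_append, List.mem_append,
          List.mem_singleton, hqs]
        split_ands <;> grind
    · exact hf.not_adj_succ hN hyf hyx hy.symm

lemma IsLongestCycle.noLongerCycle {G : SimpleGraph V} {a : V} {c : G.Walk a a}
    (hc : IsLongestCycle G c) : NoLongerCycle G c.length := by
  intro x y p hyx hlen hp
  have h3 := hc.1.three_le_length
  have hcyc : (SimpleGraph.Walk.cons hyx p).IsCycle := by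
    rw [SimpleGraph.Walk.isCycle_iff_isPath_tail_and_le_length]
    exact ⟨by simpa [SimpleGraph.Walk.isPath_def] using hp, by simp; omega⟩
  have := hc.2 _ _ hcyc
  simp at this
  omega

lemma exists_isCyclicEnum [DecidableEq V] {G : SimpleGraph V}
    {a : V} {c : G.Walk a a} (hc : c.IsCycle) {x : V} (hx : x ∈ c.support) :
    ∃ f : ℕ → V, IsCyclicEnum G c.length f ∧ f c.length = x ∧
      (∀ z, z ∈ c.support ↔ ∃ k, z = f k) ∧
      (∀ k, cSucc c (f k) = f (k + 1)) ∧ (∀ k, cPred c (f (k + 1)) = f k) := by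
  have h3 := hc.three_le_length
  have hnd := hc.support_nodup
  have hlen : c.support.tail.length = c.length := by simp
  have hmem : ∀ z, z ∈ c.support ↔ z ∈ c.support.tail := by
    intro z
    rw [SimpleGraph.Walk.mem_support_iff, or_iff_right_of_imp]
    rintro rfl
    exact SimpleGraph.Walk.end_mem_tail_support hc.not_nil
  obtain ⟨m, hm, hmx⟩ := List.getElem_of_mem ((hmem x).1 hx)
  have hlt : ∀ k, (m + k) % c.length < c.support.tail.length := fun k => by
    rw [hlen]; exact Nat.mod_lt _ (by omega)
  let f : ℕ → V := fun k => c.support.tail[(m + k) % c.length]'(hlt k)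
  have hfmem : ∀ k, f k ∈ c.support.tail := fun k => List.getElem_mem _
  have hsucc : ∀ k, cSucc c (f k) = f (k + 1) := by
    intro k
    rw [cSucc, dif_pos (hfmem k)]
    simp only [f, List.next_getElem _ hnd, hlen, Nat.mod_add_mod, Nat.add_assoc]
  have hget : ∀ i (hi : i < c.support.tail.length), c.support.tail[i] = c.getVert (i + 1) := by
    intro i hi
    rw [SimpleGraph.Walk.getVert_eq_support_getElem _ (by omega)]
    simp
  refine ⟨f, ⟨h3, ?_, ?_, ?_⟩, ?_, ?_, hsucc, ?_⟩
  · rintro i _ rfl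
    simp only [f, hget, ← Nat.add_assoc]
    have hi := hlt i
    by_cases h : (m + i) % c.length + 1 = c.length
    · have : (m + i + 1) % c.length = 0 := by
        rw [← Nat.mod_add_mod, h, Nat.mod_self]
      rw [this, h, SimpleGraph.Walk.getVert_length]
      simpa using c.adj_getVert_succ (i := 0) (by omega)
    · have : (m + i + 1) % c.length = (m + i) % c.length + 1 := by
        rw [← Nat.mod_add_mod, Nat.mod_eq_of_lt (by omega)]
      rw [this]
      exact c.adj_getVert_succ (by omega)
  · rintro i _ rfl
    simp only [f, ← Nat.add_assoc, Nat.add_mod_right]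
  · intro i j hij hj h
    have h := (hnd.getElem_inj_iff).1 h
    have := (Nat.modEq_iff_dvd' (by omega)).1 h
    have := Nat.le_of_dvd (by omega) this
    omega
  · simp only [f, Nat.add_mod_right]
    rw [← hmx]
    congr 1
    exact Nat.mod_eq_of_lt (by omega)
  · intro z
    rw [hmem]
    constructor
    · intro hz
      obtain ⟨l, hl, rfl⟩ := List.getElem_of_mem hz
      refine ⟨l + c.length - m, ?_⟩
      simp only [f]
      congr 1
      rw [show m + (l + c.length - m) = l + c.length by omega, Nat.add_mod_right,
        Nat.mod_eq_of_lt (by omega)]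
    · rintro ⟨k, rfl⟩
      exact hfmem k
  · intro k
    have hk := hfmem k
    rw [← hsucc, cSucc, dif_pos hk, cPred, dif_pos (List.next_mem _ _ hk)]
    exact List.prev_next _ hnd _ hk

/-- Every value of a cyclic enumeration is attained in any given window of one period. -/
lemma IsCyclicEnum.exists_mem_window {G : SimpleGraph V} {N : ℕ} {f : ℕ → V}
    (hf : IsCyclicEnum G N f) (m k : ℕ) : ∃ i, m ≤ i ∧ i < m + N ∧ f i = f k := by
  have h3 := hf.three_le
  have hmul : ∀ k t, f (k + t * N) = f k := by
    intro k t
    induction t with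
    | zero => simp
    | succ t ih => rw [hf.periodic (k + t * N) _ (by ring), ih]
  have hmod : ∀ k, f (k % N) = f k := fun k => by
    conv_rhs => rw [← Nat.mod_add_div k N, Nat.mul_comm, hmul]
  refine ⟨m + (k + m * N - m) % N, by omega, ?_, ?_⟩
  · have := Nat.mod_lt (k + m * N - m) (show 0 < N by omega)
    omega
  · have hm : m ≤ m * N := Nat.le_mul_of_pos_right m (by omega)
    rw [← hmod (m + _), Nat.add_mod_mod, hmod, show m + (k + m * N - m) = k + m * N by omega, hmul]

theorem stmt12 {V : Type*} [Fintype V] [DecidableEq V] (G : SimpleGraph V)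
    (hn : 3 ≤ Fintype.card V) (htough : OneTough G) (hsig : Fintype.card V ≤ sigma3 G)
    (hham : ¬ G.IsHamiltonian) {a : V} (c : G.Walk a a) (hc : IsLongestCycle G c)
    (u v : V) (hu : u ∉ c.support) (hv : v ∈ c.support)
    (huv1 : G.Adj u (cSucc c v)) (huv2 : G.Adj u (cPred c v))
    (B : Set V) (hB : B = G.neighborSet u ∪ G.neighborSet v)
    (x : V) (hx : x ∈ c.support) (hedge : G.Adj (cPred c x) (cSucc c x))
    (hx2 : cSucc c (cSucc c x) ∈ B) :
    ∀ y ∈ cPred c '' B, y ≠ cPred c x → y ≠ x → y ≠ cSucc c x → ¬ G.Adj x y := by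
  obtain ⟨f, hf, hfx, hmem, hsucc, hpred⟩ := exists_isCyclicEnum hc.1 hx
  have hN := hc.noLongerCycle
  generalize c.length = N at hf hfx hN
  have h3 := hf.three_le
  have hu' : ∀ i, u ≠ f i := fun i h => hu ((hmem u).2 ⟨i, h⟩)
  obtain ⟨j, hj₂, hjN, rfl⟩ : ∃ j, 2 ≤ j ∧ j ≤ N + 1 ∧ v = f j := by
    obtain ⟨k, rfl⟩ := (hmem v).1 hv
    obtain ⟨j, h₁, h₂, h⟩ := hf.exists_mem_window 2 k
    exact ⟨j, h₁, by omega, h.symm⟩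
  have hpred' : ∀ i, 1 ≤ i → cPred c (f i) = f (i - 1) := fun i hi => by
    rw [← hpred (i - 1), Nat.sub_add_cancel hi]
  rw [hsucc] at huv1
  rw [hpred' _ (by omega)] at huv2
  have hchord : G.Adj (f (N + 1)) (f (N - 1)) := by
    rw [← hfx, hsucc, hpred' _ (by omega)] at hedge
    exact hedge.symm
  have h₂ : G.Adj u (f 2) ∨ G.Adj (f j) (f 2) := by
    rw [← hfx, hsucc, hsucc, hf.periodic 2 _ (by omega), hB] at hx2
    exact hx2
  rintro _ ⟨b, hb, rfl⟩ hb₁ hb₂ hb₃ hadj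
  rw [hB] at hb
  by_cases hbc : b ∈ c.support
  · obtain ⟨k, rfl⟩ := (hmem b).1 hbc
    obtain ⟨l, hl₁, hl₂, hl⟩ := hf.exists_mem_window 2 k
    rw [← hl] at hb hb₁ hb₂ hb₃ hadj
    obtain ⟨i, rfl⟩ : ∃ i, l = i + 1 := ⟨l - 1, by omega⟩
    rw [hpred, ← hfx] at hb₁ hb₂ hb₃ hadj
    rw [hpred' _ (by omega)] at hb₁
    rw [hsucc, hf.periodic 1 (N + 1) (by omega)] at hb₃
    have h1 : i ≠ 1 := by rintro rfl; exact hb₃ rfl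
    have h2 : i ≠ N := by rintro rfl; exact hb₂ rfl
    have h3 : i ≠ N - 1 := by rintro rfl; exact hb₁ rfl
    exact hf.not_adj_on hN hu' hj₂ hjN huv2 huv1 hchord h₂ (by omega) (by omega) hb hadj.symm
  · have hbp : cPred c b = b := by
      rw [cPred, dif_neg fun h => hbc (List.mem_of_mem_tail h)]
    rw [hbp, ← hfx] at hadj
    exact hf.not_adj_off hN hu' hj₂ hjN huv2 huv1 hchord h₂
      (fun i h => hbc ((hmem b).2 ⟨i, h⟩)) hb hadj.symm

end
end Paper
end
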